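/- arXiv:2308.02946 — 2 statements merged into one kernel-verified Lean document; each statement's English description precedes it below -/
import Mathlib

section
/- The probability that Z_ATSP − Z_AP ≤ n^{−3/2} tends to 0 as n → ∞. -/
open MeasureTheory Finset

/-- The product measure on cost matrices: each entry independent uniform on `[0,1]`. -/
noncomputable def costMeasure (n : ℕ) : Measure (Fin n × Fin n → ℝ) :=
  Measure.pi fun _ => volume.restrict (Set.Icc 0 1)

/-- The cost of the permutation `π`: `∑ i, C (i, π i)`. -/
def permCost {n : ℕ} (C : Fin n × Fin n → ℝ) (π : Equiv.Perm (Fin n)) : ℝ :=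
  ∑ i, C (i, π i)

/-- A permutation avoiding the diagonal. -/
def IsDerangement {n : ℕ} (π : Equiv.Perm (Fin n)) : Prop := ∀ i, π i ≠ i

/-- A cyclic permutation: a single cycle through all `n` points. -/
def IsCyclicPerm {n : ℕ} (π : Equiv.Perm (Fin n)) : Prop := π.IsCycle ∧ ∀ i, π i ≠ i

/-- Optimal value of the assignment problem (diagonal forbidden). -/
noncomputable def ZAP (n : ℕ) (C : Fin n × Fin n → ℝ) : ℝ :=
  sInf {x | ∃ π : Equiv.Perm (Fin n), IsDerangement π ∧ x = permCost C π}

/-- Optimal value of the asymmetric TSP. -/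
noncomputable def ZATSP (n : ℕ) (C : Fin n × Fin n → ℝ) : ℝ :=
  sInf {x | ∃ π : Equiv.Perm (Fin n), IsCyclicPerm π ∧ x = permCost C π}

/-- The arcs in `F1` have in- and out-degree at most one and contain
no directed cycle of length `< n`. -/
def ValidArcs {n : ℕ} (F1 : Set (Fin n × Fin n)) : Prop :=
  (∀ e ∈ F1, ∀ e' ∈ F1, (e : Fin n × Fin n).1 = (e' : Fin n × Fin n).1 → e = e') ∧
  (∀ e ∈ F1, ∀ e' ∈ F1, (e : Fin n × Fin n).2 = (e' : Fin n × Fin n).2 → e = e') ∧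
  (∀ k : ℕ, 0 < k → k < n → ∀ f : ZMod k → Fin n,
    Function.Injective f → ¬ (∀ t, (f t, f (t + 1)) ∈ F1))

/-- `(F0, F1)` is a constraint pair. -/
def IsConstraint {n : ℕ} (F0 F1 : Finset (Fin n × Fin n)) : Prop :=
  Disjoint F0 F1 ∧ (∀ e ∈ F0 ∪ F1, (e : Fin n × Fin n).1 ≠ (e : Fin n × Fin n).2) ∧
    ValidArcs (F1 : Set (Fin n × Fin n))

/-- The inadmissible arcs: off-diagonal arcs not in `F1` whose addition to `F1`
violates the degree or short-cycle conditions. -/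
def Fhat0 {n : ℕ} (F1 : Finset (Fin n × Fin n)) : Set (Fin n × Fin n) :=
  {e | e.1 ≠ e.2 ∧ e ∉ F1 ∧ ¬ ValidArcs (insert e (F1 : Set (Fin n × Fin n)))}

/-- An arc not in `F0 ∪ F1 ∪ F̂0 ∪ D`. -/
def Admissible {n : ℕ} (F0 F1 : Finset (Fin n × Fin n)) (e : Fin n × Fin n) : Prop :=
  e.1 ≠ e.2 ∧ e ∉ F0 ∧ e ∉ F1 ∧ e ∉ Fhat0 F1

/-- `π` is feasible for `AP(F)`. -/
def FeasibleAP {n : ℕ} (F0 F1 : Finset (Fin n × Fin n)) (π : Equiv.Perm (Fin n)) : Prop :=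
  (∀ i, π i ≠ i) ∧ (∀ e ∈ F1, π (e : Fin n × Fin n).1 = (e : Fin n × Fin n).2) ∧
  (∀ i, (i, π i) ∉ F0 ∧ (i, π i) ∉ Fhat0 F1)

/-- Optimal value of the restricted assignment problem `AP(F)`. -/
noncomputable def ZAPF {n : ℕ} (C : Fin n × Fin n → ℝ) (F0 F1 : Finset (Fin n × Fin n)) : ℝ :=
  sInf {x | ∃ π : Equiv.Perm (Fin n), FeasibleAP F0 F1 π ∧ x = permCost C π}

/-- Condition (⋆): `|F1| ≤ n^{3ε/8}` and `|F0| ≤ n^{3ε/4}`. -/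
def StarCond {n : ℕ} (ε : ℝ) (F0 F1 : Finset (Fin n × Fin n)) : Prop :=
  (F1.card : ℝ) ≤ (n : ℝ) ^ (3 * ε / 8) ∧ (F0.card : ℝ) ≤ (n : ℝ) ^ (3 * ε / 4)

/-- `(a_i, b_j)` is an edge of `K_{A,B:F}`. -/
def EdgeKF {n : ℕ} (F0 F1 : Finset (Fin n × Fin n)) (i j : Fin n) : Prop :=
  i ≠ j ∧ (i, j) ∉ F0 ∧ (i, j) ∉ Fhat0 F1

/-- `b_j ∈ N_ζ(a_i)`: `(a_i,b_j)` is among the `ζ` cheapest edges of `K_{A,B:F}` at `a_i`. -/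
def Nout {n : ℕ} (C : Fin n × Fin n → ℝ) (F0 F1 : Finset (Fin n × Fin n)) (ζ : ℕ)
    (i : Fin n) : Set (Fin n) :=
  {j | EdgeKF F0 F1 i j ∧ {j' | EdgeKF F0 F1 i j' ∧ C (i, j') < C (i, j)}.ncard < ζ}

/-- `a_i ∈ N_ζ(b_j)`: `(a_i,b_j)` is among the `ζ` cheapest edges of `K_{A,B:F}` at `b_j`. -/
def Nin {n : ℕ} (C : Fin n × Fin n → ℝ) (F0 F1 : Finset (Fin n × Fin n)) (ζ : ℕ)
    (j : Fin n) : Set (Fin n) :=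
  {i | EdgeKF F0 F1 i j ∧ {i' | EdgeKF F0 F1 i' j ∧ C (i', j) < C (i, j)}.ncard < ζ}

/-- Forward arcs `(a_i, b_j)` of the digraph `D⃗_F(C,π)`. -/
def ForwardArc {n : ℕ} (C : Fin n × Fin n → ℝ) (F0 F1 : Finset (Fin n × Fin n)) (ζ : ℕ)
    (i j : Fin n) : Prop :=
  (i, j) ∉ F0 ∧ (i, j) ∉ F1 ∧ (i, j) ∉ Fhat0 F1 ∧ i ≠ j ∧
    (j ∈ Nout C F0 F1 ζ i ∨ i ∈ Nin C F0 F1 ζ j)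

/-- The bipartite graph on `A ⊕ B` whose edges `(a_i, b_j)` are given by a set of pairs. -/
def bipGraph {n : ℕ} (T : Finset (Fin n × Fin n)) : SimpleGraph (Fin n ⊕ Fin n) :=
  SimpleGraph.fromRel fun u v =>
    ∃ p ∈ T, u = Sum.inl (p : Fin n × Fin n).1 ∧ v = Sum.inr (p : Fin n × Fin n).2

/-- Arcs of the contraction `φ(T)`: an arc `(i₁, i₂)` for every non-matching
edge `(a_{i₁}, b_{π i₂})` of `T`. -/
def contractionArcs {n : ℕ} (π : Equiv.Perm (Fin n)) (T : Finset (Fin n × Fin n)) :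
    Set (Fin n × Fin n) :=
  {q | (q.1, π q.2) ∈ T ∧ q.1 ≠ q.2}

/-- The contraction `φ(T)` as an (undirected) graph on `[n]`: an edge `{i₁, i₂}` for
every non-matching edge `(a_{i₁}, b_{π i₂})` of `T`. -/
def contractGraph {n : ℕ} (π : Equiv.Perm (Fin n)) (T : Finset (Fin n × Fin n)) :
    SimpleGraph (Fin n) :=
  SimpleGraph.fromRel fun i₁ i₂ => (i₁, π i₂) ∈ T


namespace Pf

/-! ### Combinatorics: a uniformly random permutation of `S` -/

section Comb
variable {α : Type*} [Fintype α] [DecidableEq α]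

/-- Permutations supported in `S`. -/
def G (S : Finset α) : Finset (Equiv.Perm α) :=
  univ.filter (fun τ => ∀ x, x ∉ S → τ x = x)

lemma mem_G {S : Finset α} {τ : Equiv.Perm α} : τ ∈ G S ↔ ∀ x, x ∉ S → τ x = x := by
  simp [G]

lemma sum_G (S : Finset α) (s : α) (hs : s ∈ S) (f : Equiv.Perm α → ℕ) :
    ∑ τ ∈ G S, f τ = ∑ t ∈ S, ∑ τ ∈ G (S.erase s), f (τ * Equiv.swap s t) := by
  rw [← Finset.sum_product']
  symm
  refine Finset.sum_bij' (fun p _ => p.2 * Equiv.swap s p.1)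
    (fun τ _ => (τ⁻¹ s, τ * Equiv.swap s (τ⁻¹ s))) ?_ ?_ ?_ ?_ ?_
  · rintro ⟨t, τ⟩ h
    simp only [Finset.mem_product, mem_G] at h ⊢
    intro x hx
    have h1 : x ≠ s := fun h => hx (h ▸ hs)
    have h2 : x ≠ t := fun h' => hx (h' ▸ h.1)
    simp only [Equiv.Perm.mul_apply, Equiv.swap_apply_of_ne_of_ne h1 h2]
    exact h.2 x (fun h => hx (Finset.mem_of_mem_erase h))
  · intro τ h
    simp only [Finset.mem_product, mem_G] at h ⊢
    have h1 : τ⁻¹ s ∈ S := by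
      by_contra hc
      have := h _ hc
      have e : τ (τ⁻¹ s) = s := by simp
      rw [e] at this
      exact hc (this ▸ hs)
    refine ⟨h1, ?_⟩
    intro x hx
    by_cases hxs : x = s
    · subst hxs; simp
    have hxS : x ∉ S := fun h' => hx (Finset.mem_erase.2 ⟨hxs, h'⟩)
    have h2 : x ≠ τ⁻¹ s := fun h' => hxS (h' ▸ h1)
    simp only [Equiv.Perm.mul_apply, Equiv.swap_apply_of_ne_of_ne hxs h2]
    exact h x hxS
  · rintro ⟨t, τ⟩ h
    simp only [Finset.mem_product, mem_G] at h
    have h0 : τ s = s := h.2 s (by simp)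
    have h1 : (τ * Equiv.swap s t)⁻¹ s = t := by
      rw [Equiv.Perm.inv_eq_iff_eq]; simp [h0]
    simp only [h1]
    simp [mul_assoc]
  · intro τ h
    simp [mul_assoc]
  · rintro ⟨t, τ⟩ h
    rfl

lemma card_G : ∀ (k : ℕ) (S : Finset α), S.card = k → (G S).card = k.factorial := by
  intro k
  induction k with
  | zero =>
    intro S hS
    rw [Finset.card_eq_zero] at hS
    subst hS
    have : G (∅ : Finset α) = {1} := by
      ext τ
      simp only [mem_G, Finset.mem_singleton]
      constructor
      · intro h; ext x; simpa using h x
      · rintro rfl; simp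
    simp [this]
  | succ k ih =>
    intro S hS
    obtain ⟨s, hs⟩ : S.Nonempty := Finset.card_pos.1 (by omega)
    rw [Finset.card_eq_sum_ones, sum_G S s hs]
    have h := ih (S.erase s) (by rw [Finset.card_erase_of_mem hs]; omega)
    simp [h, hS, Nat.factorial_succ]

/-- Every nonempty `ρ`-closed set meets `B`. -/
def Hit (ρ : Equiv.Perm α) (B : Finset α) : Prop :=
  ∀ X : Finset α, X.Nonempty → (∀ x ∈ X, ρ x ∈ X) → ∃ b ∈ B, b ∈ X

lemma gap_alt (S : Finset α) (ρ : Equiv.Perm α) (B : Finset α) :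
    S.card ≤ B.card ∨ ∃ s ∈ S, ∃ t ∈ S, ∃ X : Finset α, s ∈ X ∧ (∀ x ∈ X, x ∈ S → x = s) ∧
      (∀ b ∈ B, b ∉ X) ∧ (∀ x ∈ X, ρ x = t ∨ (ρ x ∈ X ∧ ρ x ≠ s ∧ ρ x ≠ t)) := by
  classical
  have hex : ∀ s ∈ S, ∃ r : ℕ, 0 < r ∧ (ρ ^ r) s ∈ S := fun s hs =>
    ⟨orderOf ρ, orderOf_pos ρ, by simpa [pow_orderOf_eq_one] using hs⟩
  have hmin : ∀ s ∈ S, ∃ r : ℕ, 0 < r ∧ (ρ ^ r) s ∈ S ∧ ∀ i, 0 < i → i < r → (ρ ^ i) s ∉ S := by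
    intro s hs
    refine ⟨Nat.find (hex s hs), (Nat.find_spec (hex s hs)).1, (Nat.find_spec (hex s hs)).2, ?_⟩
    intro i hi hir h
    exact Nat.find_min (hex s hs) hir ⟨hi, h⟩
  choose! r hr0 hrS hrm using hmin
  by_cases hall : ∀ s ∈ S, ∃ i, i < r s ∧ (ρ ^ i) s ∈ B
  · left
    choose! q hq hqB using hall
    refine Finset.card_le_card_of_injOn (fun s => (ρ ^ q s) s) (fun s hs => hqB s hs) ?_
    have key : ∀ s ∈ S, ∀ s' ∈ S, q s ≤ q s' → (ρ ^ q s) s = (ρ ^ q s') s' → s = s' := by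
      intro s hs s' hs' hle h
      obtain ⟨d, hd⟩ := Nat.exists_eq_add_of_le hle
      rw [hd, pow_add, Equiv.Perm.mul_apply] at h
      have h1 : s = (ρ ^ d) s' := (ρ ^ q s).injective h
      rcases Nat.eq_zero_or_pos d with h0 | h0
      · simpa [h0] using h1
      · exact absurd (h1 ▸ hs) (hrm s' hs' d h0 (by have := hq s' hs'; omega))
    intro s hs s' hs' h
    rcases le_total (q s) (q s') with h1 | h1
    · exact key s hs s' hs' h1 h
    · exact (key s' hs' s hs h1 h.symm).symm
  · right
    push Not at hall
    obtain ⟨s, hs, hB⟩ := hall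
    refine ⟨s, hs, (ρ ^ r s) s, hrS s hs, (Finset.range (r s)).image (fun i => (ρ ^ i) s),
      ?_, ?_, ?_, ?_⟩
    · exact Finset.mem_image.2 ⟨0, Finset.mem_range.2 (hr0 s hs), by simp⟩
    · intro x hx hxS
      obtain ⟨i, hi, rfl⟩ := Finset.mem_image.1 hx
      rcases Nat.eq_zero_or_pos i with h0 | h0
      · simp [h0]
      · exact absurd hxS (hrm s hs i h0 (Finset.mem_range.1 hi))
    · intro b hb hx
      obtain ⟨i, hi, rfl⟩ := Finset.mem_image.1 hx
      exact hB i (Finset.mem_range.1 hi) hb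
    · intro x hx
      obtain ⟨i, hi, rfl⟩ := Finset.mem_image.1 hx
      have hi := Finset.mem_range.1 hi
      have e : ρ ((ρ ^ i) s) = (ρ ^ (i + 1)) s := by rw [pow_succ']; rfl
      simp only [e]
      rcases Nat.lt_or_ge (i + 1) (r s) with h | h
      · right
        have hn := hrm s hs (i + 1) (by omega) h
        refine ⟨Finset.mem_image.2 ⟨i + 1, Finset.mem_range.2 h, rfl⟩, ?_, ?_⟩
        · intro h'; rw [h'] at hn; exact hn hs
        · intro h'; rw [h'] at hn; exact hn (hrS s hs)
      · left
        have : i + 1 = r s := by omega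
        rw [this]

open Classical in
lemma count_hit : ∀ (k : ℕ) (S : Finset α), S.card = k + 1 → ∀ (ρ : Equiv.Perm α) (B : Finset α),
    ∑ τ ∈ G S, (if Hit (τ * ρ) B then 1 else 0) ≤ k.factorial * B.card := by
  intro k
  induction k with
  | zero =>
    intro S hS ρ B
    obtain ⟨s, rfl⟩ := Finset.card_eq_one.1 hS
    have hc := card_G 1 ({s} : Finset α) (by simp)
    rcases Finset.eq_empty_or_nonempty B with rfl | hB
    · refine le_of_eq ?_
      simp only [Finset.card_empty, mul_zero]
      refine Finset.sum_eq_zero fun τ _ => ?_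
      rw [if_neg]
      intro h
      obtain ⟨b, hb, _⟩ := h univ ⟨s, by simp⟩ (by simp)
      simp at hb
    · calc _ ≤ ∑ τ ∈ G {s}, 1 := Finset.sum_le_sum fun τ _ => by split_ifs <;> simp
        _ = 1 := by simpa using hc
        _ ≤ _ := by simpa using hB
  | succ k ih =>
    intro S hS ρ B
    rcases gap_alt S ρ B with h | ⟨s, hs, t, ht, X, hsX, hXS, hXB, hX⟩
    · calc _ ≤ ∑ τ ∈ G S, 1 := Finset.sum_le_sum fun τ _ => by split_ifs <;> simp
        _ = (k + 1 + 1).factorial := by simpa using card_G _ S hS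
        _ = (k + 1).factorial * S.card := by rw [hS, Nat.factorial_succ (k + 1), mul_comm]
        _ ≤ _ := Nat.mul_le_mul_left _ h
    · rw [sum_G S s hs, ← Finset.add_sum_erase S _ ht]
      have h0 : ∑ τ ∈ G (S.erase s), (if Hit (τ * Equiv.swap s t * ρ) B then 1 else 0) = 0 := by
        refine Finset.sum_eq_zero fun τ hτ => ?_
        rw [if_neg]
        intro h
        obtain ⟨b, hb, hbX⟩ := h X ⟨s, hsX⟩ (by
          intro x hx
          have hfix : ∀ y ∈ X, τ y = y := by
            intro y hy
            refine mem_G.1 hτ y ?_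
            intro hy'
            rw [Finset.mem_erase] at hy'
            exact hy'.1 (hXS y hy hy'.2)
          simp only [Equiv.Perm.mul_apply]
          rcases hX x hx with h1 | ⟨h1, h2, h3⟩
          · rw [h1, Equiv.swap_apply_right, hfix s hsX]; exact hsX
          · rw [Equiv.swap_apply_of_ne_of_ne h2 h3, hfix _ h1]; exact h1)
        exact hXB b hb hbX
      rw [h0, zero_add]
      calc _ ≤ ∑ u ∈ S.erase t, k.factorial * B.card := by
            refine Finset.sum_le_sum fun u _ => ?_
            simp only [mul_assoc]
            exact ih (S.erase s) (by rw [Finset.card_erase_of_mem hs]; omega) _ _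
        _ = _ := by
            rw [Finset.sum_const, Finset.card_erase_of_mem ht, hS, Nat.factorial_succ]
            simp [mul_assoc]

end Comb

/-! ### The optimisation problems -/

section Prob
variable {n : ℕ}

/-- `π` avoids the forbidden pairs `(i, τ⁻¹ i)`. -/
def Feas (τ π : Equiv.Perm (Fin n)) : Prop := ∀ i, τ (π i) ≠ i

/-- `π` is optimal up to `δ` for the problem with forbidden pairs `(i, τ⁻¹ i)`. -/
def Near (δ : ℝ) (τ : Equiv.Perm (Fin n)) (C : Fin n × Fin n → ℝ) (π : Equiv.Perm (Fin n)) : Prop :=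
  Feas τ π ∧ ∀ π', Feas τ π' → permCost C π ≤ permCost C π' + δ

/-- Some near-optimal permutation uses `(a,b)`. -/
def U (δ : ℝ) (τ : Equiv.Perm (Fin n)) (a b : Fin n) : Set (Fin n × Fin n → ℝ) :=
  {C | ∃ π, Near δ τ C π ∧ π a = b}

/-- Every optimal derangement uses `(a,b)`. -/
def W (a b : Fin n) : Set (Fin n × Fin n → ℝ) :=
  {C | ∀ π, Near 0 1 C π → π a = b}

/-- Some near-optimal derangement uses `(a,b)`, some optimal one does not. -/
def V (δ : ℝ) (a b : Fin n) : Set (Fin n × Fin n → ℝ) :=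
  {C | (∃ π, Near δ 1 C π ∧ π a = b) ∧ ∃ π, Near 0 1 C π ∧ π a ≠ b}

/-- Some optimal derangement uses `(a,b)`, some near-optimal one does not. -/
def Amb (δ : ℝ) (a b : Fin n) : Set (Fin n × Fin n → ℝ) :=
  {C | (∃ π, Near 0 1 C π ∧ π a = b) ∧ ∃ π, Near δ 1 C π ∧ π a ≠ b}

/-- Some near-optimal `π` has `τ * π` cyclic. -/
def Ev (δ : ℝ) (τ : Equiv.Perm (Fin n)) : Set (Fin n × Fin n → ℝ) :=
  {C | ∃ π, Near δ τ C π ∧ IsCyclicPerm (τ * π)}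

lemma measurable_permCost (π : Equiv.Perm (Fin n)) :
    Measurable (fun C : Fin n × Fin n → ℝ => permCost C π) := by
  unfold permCost; fun_prop

lemma meas_Near (δ : ℝ) (τ π : Equiv.Perm (Fin n)) : MeasurableSet {C | Near δ τ C π} := by
  have e : {C : Fin n × Fin n → ℝ | Near δ τ C π} = {_C | Feas τ π} ∩
      ⋂ π', ⋂ (_ : Feas τ π'), {C | permCost C π ≤ permCost C π' + δ} := by
    ext C; simp [Near]
  rw [e]
  refine (MeasurableSet.const _).inter ?_
  refine MeasurableSet.iInter fun π' => MeasurableSet.iInter fun _ => ?_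
  exact measurableSet_le (measurable_permCost π) ((measurable_permCost π').add_const δ)

lemma meas_ex (δ : ℝ) (τ : Equiv.Perm (Fin n)) (P : Equiv.Perm (Fin n) → Prop) :
    MeasurableSet {C | ∃ π, Near δ τ C π ∧ P π} := by
  rw [Set.ofPred_exists]
  exact MeasurableSet.iUnion fun π => (meas_Near δ τ π).inter (MeasurableSet.const _)

lemma meas_U (δ : ℝ) (τ : Equiv.Perm (Fin n)) (a b : Fin n) : MeasurableSet (U δ τ a b) :=
  meas_ex δ τ _

lemma meas_V (δ : ℝ) (a b : Fin n) : MeasurableSet (V δ a b) :=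
  (meas_ex δ 1 _).inter (meas_ex 0 1 _)

lemma meas_Amb (δ : ℝ) (a b : Fin n) : MeasurableSet (Amb δ a b) :=
  (meas_ex 0 1 _).inter (meas_ex δ 1 _)

lemma meas_Ev (δ : ℝ) (τ : Equiv.Perm (Fin n)) : MeasurableSet (Ev δ τ) :=
  meas_ex δ τ _

lemma meas_W (a b : Fin n) : MeasurableSet (W a b) := by
  have : W a b = {C | ∃ π, Near 0 1 C π ∧ π a ≠ b}ᶜ := by
    ext C; simp [W]
  rw [this]
  exact (meas_ex 0 1 _).compl

instance : IsProbabilityMeasure ((volume : Measure ℝ).restrict (Set.Icc 0 1)) :=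
  ⟨by simp⟩

instance : IsProbabilityMeasure (costMeasure n) := by
  unfold costMeasure; infer_instance

lemma measurePreserving_comp (φ : Equiv.Perm (Fin n × Fin n)) :
    MeasurePreserving (fun C : Fin n × Fin n → ℝ => fun x => C (φ x)) (costMeasure n)
      (costMeasure n) := by
  have h := measurePreserving_piCongrLeft
    (fun _ : Fin n × Fin n => (volume : Measure ℝ).restrict (Set.Icc 0 1)) φ.symm
  have e : (fun C : Fin n × Fin n → ℝ => fun x => C (φ x))
      = MeasurableEquiv.piCongrLeft (fun _ : Fin n × Fin n => ℝ) φ.symm := by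
    funext C x
    have := MeasurableEquiv.piCongrLeft_apply_apply (β := fun _ : Fin n × Fin n => ℝ)
      φ.symm C (φ x)
    simpa using this.symm
  rw [e]
  exact h

/-- Slicing: a measurable event all of whose `e`-slices have diameter `≤ δ`. -/
lemma slice_bound (A : Set (Fin n × Fin n → ℝ)) (hA : MeasurableSet A) (e : Fin n × Fin n)
    (δ : ℝ) (h : ∀ C : Fin n × Fin n → ℝ, ∀ x y, Function.update C e x ∈ A →
      Function.update C e y ∈ A → y - x ≤ δ) :
    costMeasure n A ≤ ENNReal.ofReal δ := by
  classical
  rw [← lintegral_indicator_one hA]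
  have hm : Measurable (A.indicator (1 : (Fin n × Fin n → ℝ) → ENNReal)) :=
    measurable_one.indicator hA
  have key := lintegral_le_of_lmarginal_le
    (μ := fun _ : Fin n × Fin n => (volume : Measure ℝ).restrict (Set.Icc 0 1))
    (f := A.indicator (1 : (Fin n × Fin n → ℝ) → ENNReal)) (g := fun _ => ENNReal.ofReal δ)
    {e} hm measurable_const ?_
  · refine key.trans ?_
    simp
  · intro C
    rw [lmarginal_singleton, lmarginal_singleton]
    have hs : MeasurableSet {x : ℝ | Function.update C e x ∈ A} :=
      (measurable_update C) hA
    have e1 : (fun x : ℝ => A.indicator (1 : (Fin n × Fin n → ℝ) → ENNReal)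
        (Function.update C e x)) = {x : ℝ | Function.update C e x ∈ A}.indicator 1 := by
      funext x; rfl
    beta_reduce
    rw [e1, lintegral_indicator_one hs]
    simp only [lintegral_const, measure_univ, mul_one]
    refine (Measure.restrict_apply_le _ _).trans ((Real.volume_le_diam _).trans ?_)
    refine Metric.ediam_le fun x hx y hy => ?_
    rw [edist_dist, Real.dist_eq]
    exact ENNReal.ofReal_le_ofReal (abs_le.2 ⟨by linarith [h C x y hx hy], h C y x hy hx⟩)

lemma permCost_update_of_ne (C : Fin n × Fin n → ℝ) (a b : Fin n) (x y : ℝ)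
    (π : Equiv.Perm (Fin n)) (h : π a ≠ b) :
    permCost (Function.update C (a, b) x) π = permCost (Function.update C (a, b) y) π := by
  unfold permCost
  refine Finset.sum_congr rfl fun i _ => ?_
  have : (i, π i) ≠ (a, b) := by
    intro h'
    rw [Prod.mk.injEq] at h'
    exact h (h'.1 ▸ h'.2)
  simp [Function.update_of_ne this]

lemma permCost_update_of_eq (C : Fin n × Fin n → ℝ) (a b : Fin n) (x y : ℝ)
    (π : Equiv.Perm (Fin n)) (h : π a = b) :
    permCost (Function.update C (a, b) y) π = permCost (Function.update C (a, b) x) π + (y - x) := by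
  unfold permCost
  rw [← Finset.add_sum_erase _ _ (Finset.mem_univ a), ← Finset.add_sum_erase univ
    (fun i => Function.update C (a, b) x (i, π i)) (Finset.mem_univ a)]
  have : ∑ i ∈ univ.erase a, Function.update C (a, b) y (i, π i)
      = ∑ i ∈ univ.erase a, Function.update C (a, b) x (i, π i) := by
    refine Finset.sum_congr rfl fun i hi => ?_
    have : (i, π i) ≠ (a, b) := by
      intro h'
      rw [Prod.mk.injEq] at h'
      exact (Finset.mem_erase.1 hi).1 h'.1
    simp [Function.update_of_ne this]
  rw [this, h]
  simp only [Function.update_self]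
  ring

lemma V_bound (δ : ℝ) (a b : Fin n) : costMeasure n (V δ a b) ≤ ENNReal.ofReal δ := by
  refine slice_bound _ (meas_V δ a b) (a, b) δ ?_
  rintro C x y ⟨-, M, hM, hMb⟩ ⟨⟨π, hπ, hπb⟩, -⟩
  have h1 := hM.2 π hπ.1
  have h2 := hπ.2 M hM.1
  have h3 := permCost_update_of_ne C a b x y M hMb
  have h4 := permCost_update_of_eq C a b x y π hπb
  linarith

lemma Amb_bound (δ : ℝ) (a b : Fin n) : costMeasure n (Amb δ a b) ≤ ENNReal.ofReal δ := by
  refine slice_bound _ (meas_Amb δ a b) (a, b) δ ?_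
  rintro C x y ⟨-, π, hπ, hπb⟩ ⟨⟨M, hM, hMb⟩, -⟩
  have h1 := hM.2 π hπ.1
  have h2 := hπ.2 M hM.1
  have h3 := permCost_update_of_ne C a b x y π hπb
  have h4 := permCost_update_of_eq C a b x y M hMb
  linarith

/-- transport of the problem `1` to the problem `τ` by permuting columns -/
lemma near_transport (δ : ℝ) (τ π : Equiv.Perm (Fin n)) (C : Fin n × Fin n → ℝ) :
    Near δ 1 (fun x => C (x.1, τ⁻¹ x.2)) (τ * π) ↔ Near δ τ C π := by
  have hc : ∀ π' : Equiv.Perm (Fin n),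
      permCost (fun x => C (x.1, τ⁻¹ x.2)) (τ * π') = permCost C π' := by
    intro π'; simp [permCost]
  have hf : ∀ π' : Equiv.Perm (Fin n), Feas 1 (τ * π') ↔ Feas τ π' := by
    intro π'; simp [Feas]
  unfold Near
  rw [hf, hc]
  refine and_congr_right fun _ => ⟨fun h π' h' => ?_, fun h π' h' => ?_⟩
  · have := h (τ * π') ((hf π').2 h')
    rwa [hc] at this
  · have := h (τ⁻¹ * π') ((hf _).1 (by simpa using h'))
    rw [← hc (τ⁻¹ * π')] at this
    simpa using this

/-- conjugation symmetry of problem `1` -/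
lemma near_conj (δ : ℝ) (s π : Equiv.Perm (Fin n)) (C : Fin n × Fin n → ℝ) :
    Near δ 1 (fun x => C (s x.1, s x.2)) (s⁻¹ * π * s) ↔ Near δ 1 C π := by
  have hc : ∀ π' : Equiv.Perm (Fin n),
      permCost (fun x => C (s x.1, s x.2)) (s⁻¹ * π' * s) = permCost C π' := by
    intro π'
    simp only [permCost, Equiv.Perm.mul_apply]
    rw [← Equiv.sum_comp s (fun i => C (i, π' i))]
    simp
  have hf : ∀ π' : Equiv.Perm (Fin n), Feas 1 (s⁻¹ * π' * s) ↔ Feas 1 π' := by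
    intro π'
    simp only [Feas, Equiv.Perm.mul_apply, Equiv.Perm.one_apply, ne_eq,
      Equiv.Perm.inv_eq_iff_eq]
    exact ⟨fun h i => by simpa using h (s⁻¹ i), fun h i => h (s i)⟩
  have he : ∀ π' : Equiv.Perm (Fin n), s⁻¹ * (s * π' * s⁻¹) * s = π' := by
    intro π'; simp [mul_assoc]
  unfold Near
  rw [hf, hc]
  refine and_congr_right fun _ => ⟨fun h π' h' => ?_, fun h π' h' => ?_⟩
  · have := h (s⁻¹ * π' * s) ((hf π').2 h')
    rwa [hc] at this
  · have := h (s * π' * s⁻¹) ((hf _).1 (by rwa [he]))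
    rw [← hc (s * π' * s⁻¹), he] at this
    exact this

lemma Ev_eq (δ : ℝ) (τ : Equiv.Perm (Fin n)) :
    costMeasure n (Ev δ τ) = costMeasure n (Ev δ 1) := by
  have h := (measurePreserving_comp ((Equiv.refl (Fin n)).prodCongr τ⁻¹)).measure_preimage
    (meas_Ev δ 1).nullMeasurableSet
  rw [← h]
  congr 1
  ext C
  simp only [Ev, Set.mem_ofPred_eq, Set.mem_preimage, one_mul]
  constructor
  · rintro ⟨π, h1, h2⟩
    exact ⟨τ * π, (near_transport δ τ π C).2 h1, h2⟩
  · rintro ⟨π, h1, h2⟩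
    refine ⟨τ⁻¹ * π, (near_transport δ τ _ C).1 (by rw [mul_inv_cancel_left]; exact h1), by simpa using h2⟩

lemma U_eq (δ : ℝ) (τ : Equiv.Perm (Fin n)) (a b : Fin n) :
    costMeasure n (U δ τ a b) = costMeasure n (U δ 1 a (τ b)) := by
  have h := (measurePreserving_comp ((Equiv.refl (Fin n)).prodCongr τ⁻¹)).measure_preimage
    (meas_U δ 1 a (τ b)).nullMeasurableSet
  rw [← h]
  congr 1
  ext C
  simp only [U, Set.mem_ofPred_eq, Set.mem_preimage]
  constructor
  · rintro ⟨π, h1, h2⟩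
    exact ⟨τ * π, (near_transport δ τ π C).2 h1, by simp [h2]⟩
  · rintro ⟨π, h1, h2⟩
    refine ⟨τ⁻¹ * π, (near_transport δ τ _ C).1 (by rw [mul_inv_cancel_left]; exact h1), by simp [h2]⟩

lemma W_eq (a b c : Fin n) (hb : b ≠ a) (hc : c ≠ a) :
    costMeasure n (W a b) = costMeasure n (W a c) := by
  set s : Equiv.Perm (Fin n) := Equiv.swap b c with hs
  have hsa : s a = a := Equiv.swap_apply_of_ne_of_ne hb.symm hc.symm
  have hsc : s c = b := by simp [hs]
  have h := (measurePreserving_comp (s.prodCongr s)).measure_preimage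
    (meas_W a c).nullMeasurableSet
  rw [← h]
  congr 1
  ext C
  simp only [W, Set.mem_ofPred_eq, Set.mem_preimage]
  constructor
  · intro h π hπ
    have e : s⁻¹ * (s * π * s⁻¹) * s = π := by simp [mul_assoc]
    have h1 := h (s * π * s⁻¹) ((near_conj 0 s _ C).1 (by rw [e]; exact hπ))
    have hsa' : s⁻¹ a = a := by rw [Equiv.Perm.inv_eq_iff_eq, hsa]
    rw [Equiv.Perm.mul_apply, Equiv.Perm.mul_apply, hsa', ← hsc] at h1
    exact s.injective h1
  · intro h π hπ
    have h1 := h (s⁻¹ * π * s) ((near_conj 0 s _ C).2 hπ)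
    rw [Equiv.Perm.mul_apply, Equiv.Perm.mul_apply, hsa, Equiv.Perm.inv_eq_iff_eq, hsc] at h1
    exact h1

lemma exists_cyclic (hn : 2 ≤ n) : ∃ π : Equiv.Perm (Fin n), IsCyclicPerm π := by
  obtain ⟨m, rfl⟩ := Nat.exists_eq_add_of_le' hn
  refine ⟨finRotate (m + 2), isCycle_finRotate, fun i => ?_⟩
  have := support_finRotate (n := m)
  have hi : i ∈ (finRotate (m + 2)).support := by rw [this]; simp
  exact Equiv.Perm.mem_support.1 hi

lemma exists_opt (hn : 2 ≤ n) (C : Fin n × Fin n → ℝ) : ∃ π, Near 0 1 C π := by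
  classical
  obtain ⟨p, hp⟩ := exists_cyclic hn
  obtain ⟨π, hπ, hmin⟩ := Finset.exists_min_image
    (univ.filter (fun π : Equiv.Perm (Fin n) => Feas 1 π)) (fun π => permCost C π)
    ⟨p, Finset.mem_filter.2 ⟨Finset.mem_univ _, fun i => hp.2 i⟩⟩
  refine ⟨π, by simpa using hπ, fun π' h' => ?_⟩
  simpa using hmin π' (by simpa using h')

lemma Near.mono {δ : ℝ} (hδ : 0 ≤ δ) {τ π : Equiv.Perm (Fin n)} {C : Fin n × Fin n → ℝ}
    (h : Near 0 τ C π) : Near δ τ C π :=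
  ⟨h.1, fun π' h' => by linarith [h.2 π' h']⟩

lemma W_bound (hn : 2 ≤ n) (a b : Fin n) (hb : b ≠ a) :
    costMeasure n (W a b) ≤ ((n - 1 : ℕ) : ENNReal)⁻¹ := by
  have hpos : ((n - 1 : ℕ) : ENNReal) ≠ 0 := by
    simp only [ne_eq, Nat.cast_eq_zero]; omega
  rw [ENNReal.le_inv_iff_mul_le, mul_comm]
  have h1 : ∑ c ∈ univ.erase a, costMeasure n (W a c) = ((n - 1 : ℕ) : ENNReal) * costMeasure n (W a b) := by
    rw [Finset.sum_congr rfl (fun c hc => W_eq a c b (Finset.mem_erase.1 hc).1 hb)]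
    simp
  rw [← h1, ← measure_biUnion_finset]
  · exact prob_le_one
  · intro c _ d _ hcd
    refine Set.disjoint_left.2 fun C h1 h2 => ?_
    obtain ⟨π, hπ⟩ := exists_opt hn C
    exact hcd ((h1 π hπ).symm.trans (h2 π hπ))
  · intro c _
    exact meas_W a c

lemma U_bound (hn : 2 ≤ n) (δ : ℝ) (a b : Fin n) (hb : b ≠ a) :
    costMeasure n (U δ 1 a b) ≤ ((n - 1 : ℕ) : ENNReal)⁻¹ + ENNReal.ofReal δ := by
  refine le_trans ?_ (add_le_add (W_bound hn a b hb) (V_bound δ a b))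
  refine le_trans (measure_mono ?_) (measure_union_le _ _)
  intro C hC
  by_cases h : C ∈ W a b
  · exact Or.inl h
  · right
    refine ⟨hC, ?_⟩
    simpa [W] using h

/-- The exceptional event for `τ` at `a`. -/
def Bad (δ : ℝ) (τ : Equiv.Perm (Fin n)) (a : Fin n) : Set (Fin n × Fin n → ℝ) :=
  {C | τ a ≠ a ∧ (C ∈ U δ 1 a (τ⁻¹ a) ∨ C ∈ U δ τ a a)}

lemma Bad_bound (hn : 2 ≤ n) (δ : ℝ) (τ : Equiv.Perm (Fin n)) (a : Fin n) :
    costMeasure n (Bad δ τ a) ≤ 2 * (((n - 1 : ℕ) : ENNReal)⁻¹ + ENNReal.ofReal δ) := by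
  by_cases h : τ a = a
  · have : Bad δ τ a = ∅ := by ext C; simp [Bad, h]
    simp [this]
  · have h' : τ⁻¹ a ≠ a := by
      intro h'
      rw [Equiv.Perm.inv_eq_iff_eq] at h'
      exact h h'.symm
    rw [two_mul]
    refine le_trans ?_ (add_le_add (U_bound hn δ a _ h') (U_bound hn δ a _ h))
    rw [← U_eq δ τ a a]
    refine le_trans (measure_mono ?_) (measure_union_le _ _)
    intro C hC
    exact hC.2

lemma meas_Bad (δ : ℝ) (τ : Equiv.Perm (Fin n)) (a : Fin n) : MeasurableSet (Bad δ τ a) :=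
  (MeasurableSet.const _).inter ((meas_U _ _ _ _).union (meas_U _ _ _ _))

/-- Good event. -/
def Gd (δ : ℝ) (τ : Equiv.Perm (Fin n)) : Set (Fin n × Fin n → ℝ) :=
  Ev δ τ \ ⋃ a, Bad δ τ a

lemma meas_Gd (δ : ℝ) (τ : Equiv.Perm (Fin n)) : MeasurableSet (Gd δ τ) :=
  (meas_Ev δ τ).diff (MeasurableSet.iUnion fun a => meas_Bad δ τ a)

open Classical in
lemma Gd_hit {δ : ℝ} (hδ : 0 ≤ δ) (τ M : Equiv.Perm (Fin n)) (C : Fin n × Fin n → ℝ)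
    (hM : Near 0 1 C M) (hC : C ∈ Gd δ τ) (i0 : Fin n) :
    Hit (τ * M) (insert i0 (univ.filter (fun i => C ∈ Amb δ i (M i)))) := by
  obtain ⟨⟨π, hπ, hcyc⟩, hbad⟩ := hC
  simp only [Set.mem_iUnion, not_exists] at hbad
  have hMτ : Feas τ M := by
    intro a ha
    have ha' : M a = τ⁻¹ a := by rw [Equiv.Perm.eq_inv_iff_eq]; exact ha
    by_cases h : τ a = a
    · refine hM.1 a ?_
      rw [Equiv.Perm.one_apply, ha', Equiv.Perm.inv_eq_iff_eq, h]
    · exact hbad a ⟨h, Or.inl ⟨M, hM.mono hδ, ha'⟩⟩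
  have hπ1 : Feas 1 π := by
    intro a ha
    rw [Equiv.Perm.one_apply] at ha
    by_cases h : τ a = a
    · exact hπ.1 a (by rw [ha, h])
    · exact hbad a ⟨h, Or.inr ⟨π, hπ, ha⟩⟩
  have hπn : Near δ 1 C π :=
    ⟨hπ1, fun π' h' => by linarith [hπ.2 M hMτ, hM.2 π' h']⟩
  intro X hX hXc
  by_contra hno
  push Not at hno
  have hag : ∀ x ∈ X, π x = M x := by
    intro x hx
    by_contra hne
    refine hno x (Finset.mem_insert_of_mem ?_) hx
    simp only [Finset.mem_filter, Finset.mem_univ, true_and]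
    exact ⟨⟨M, hM, rfl⟩, π, hπn, hne⟩
  have hcl : ∀ x ∈ X, (τ * π) x ∈ X := by
    intro x hx
    have := hXc x hx
    rwa [Equiv.Perm.mul_apply, hag x hx]
  obtain ⟨x, hx⟩ := hX
  obtain ⟨i, hi⟩ := hcyc.1.exists_pow_eq (hcyc.2 x) (hcyc.2 i0)
  have hpow : ∀ j : ℕ, ((τ * π) ^ j) x ∈ X := by
    intro j
    induction j with
    | zero => simpa using hx
    | succ j ih => rw [pow_succ', Equiv.Perm.mul_apply]; exact hcl _ ih
  exact hno i0 (Finset.mem_insert_self _ _) (hi ▸ hpow i)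

open Classical in
lemma main_bound (hn : 2 ≤ n) {δ : ℝ} (hδ : 0 ≤ δ) (k : ℕ) (hk : k + 1 ≤ n) :
    costMeasure n (Ev δ 1) ≤
      ((k + 1 : ℕ) : ENNReal) * (2 * (((n - 1 : ℕ) : ENNReal)⁻¹ + ENNReal.ofReal δ)) +
      (1 + (n : ENNReal) * n * ENNReal.ofReal δ) * ((k + 1 : ℕ) : ENNReal)⁻¹ := by
  set η : ENNReal := 2 * (((n - 1 : ℕ) : ENNReal)⁻¹ + ENNReal.ofReal δ) with hη
  obtain ⟨S, -, hS⟩ := Finset.exists_subset_card_eq (s := (univ : Finset (Fin n))) (n := k + 1)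
    (by simpa using hk)
  have hG := card_G (k + 1) S hS
  let i0 : Fin n := ⟨0, by omega⟩
  have h1 : ∀ τ ∈ G S, costMeasure n (Ev δ 1) ≤ ((k + 1 : ℕ) : ENNReal) * η
      + costMeasure n (Gd δ τ) := by
    intro τ hτ
    rw [← Ev_eq δ τ]
    have hsub : Ev δ τ ⊆ (⋃ a ∈ S, Bad δ τ a) ∪ Gd δ τ := by
      intro C hC
      by_cases h : C ∈ ⋃ a, Bad δ τ a
      · left
        obtain ⟨a, ha⟩ := Set.mem_iUnion.1 h
        have haS : a ∈ S := by
          by_contra hc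
          exact ha.1 (mem_G.1 hτ a hc)
        exact Set.mem_biUnion haS ha
      · exact Or.inr ⟨hC, h⟩
    refine (measure_mono hsub).trans ((measure_union_le _ _).trans (add_le_add ?_ le_rfl))
    refine (measure_biUnion_finset_le _ _).trans ?_
    refine (Finset.sum_le_sum fun a _ => Bad_bound hn δ τ a).trans ?_
    simp [hS, hη]
  have h2 : ∑ τ ∈ G S, costMeasure n (Gd δ τ) ≤
      (k.factorial : ENNReal) * (1 + (n : ENNReal) * n * ENNReal.ofReal δ) := by
    have e1 : ∀ τ ∈ G S, costMeasure n (Gd δ τ)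
        = ∫⁻ C, (Gd δ τ).indicator 1 C ∂(costMeasure n) :=
      fun τ _ => (lintegral_indicator_one (meas_Gd δ τ)).symm
    rw [Finset.sum_congr rfl e1, ← lintegral_finsetSum _
      (fun τ _ => measurable_one.indicator (meas_Gd δ τ))]
    have hpt : ∀ C : Fin n × Fin n → ℝ, ∑ τ ∈ G S, (Gd δ τ).indicator (1 : (Fin n × Fin n → ℝ) → ENNReal) C ≤
        (k.factorial : ENNReal) * (1 + ∑ e : Fin n × Fin n,
          (Amb δ e.1 e.2).indicator (1 : (Fin n × Fin n → ℝ) → ENNReal) C) := by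
      intro C
      obtain ⟨M, hM⟩ := exists_opt hn C
      set B := insert i0 (univ.filter (fun i => C ∈ Amb δ i (M i))) with hB
      have c1 := count_hit k S hS M B
      have c2 : ∑ τ ∈ G S, (Gd δ τ).indicator (1 : (Fin n × Fin n → ℝ) → ENNReal) C ≤
          ((∑ τ ∈ G S, (if Hit (τ * M) B then 1 else 0) : ℕ) : ENNReal) := by
        push_cast
        refine Finset.sum_le_sum fun τ _ => ?_
        by_cases hC : C ∈ Gd δ τ
        · rw [if_pos (Gd_hit hδ τ M C hM hC i0)]
          simp [hC]
        · simp [hC]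
      refine c2.trans ((Nat.cast_le.2 c1).trans ?_)
      rw [Nat.cast_mul]
      gcongr
      have c3 : B.card ≤ 1 + (univ.filter (fun i => C ∈ Amb δ i (M i))).card := by
        rw [add_comm]; exact Finset.card_insert_le _ _
      refine (Nat.cast_le.2 c3).trans ?_
      rw [Nat.cast_add, Nat.cast_one]
      gcongr
      rw [Finset.card_filter, Nat.cast_sum, Fintype.sum_prod_type]
      refine Finset.sum_le_sum fun i _ => ?_
      refine le_trans ?_ (Finset.single_le_sum
        (f := fun j => (Amb δ i j).indicator (1 : (Fin n × Fin n → ℝ) → ENNReal) C)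
        (fun _ _ => bot_le) (Finset.mem_univ (M i)))
      by_cases hC : C ∈ Amb δ i (M i) <;> simp [hC]
    refine (lintegral_mono hpt).trans ?_
    have hmA : ∀ e : Fin n × Fin n, Measurable ((Amb δ e.1 e.2).indicator (1 : (Fin n × Fin n → ℝ) → ENNReal)) :=
      fun e => measurable_one.indicator (meas_Amb δ e.1 e.2)
    rw [lintegral_const_mul _ (by fun_prop), lintegral_add_left measurable_const,
      lintegral_finsetSum _ (fun e _ => hmA e)]
    gcongr
    · simp
    · refine (Finset.sum_le_sum fun e _ => ?_ :
        _ ≤ ∑ e : Fin n × Fin n, ENNReal.ofReal δ).trans ?_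
      · rw [lintegral_indicator_one (meas_Amb δ e.1 e.2)]
        exact Amb_bound δ e.1 e.2
      · simp
  have h3 : ((k + 1).factorial : ENNReal) * costMeasure n (Ev δ 1) ≤
      ((k + 1).factorial : ENNReal) * (((k + 1 : ℕ) : ENNReal) * η) +
      (k.factorial : ENNReal) * (1 + (n : ENNReal) * n * ENNReal.ofReal δ) := by
    have := Finset.sum_le_sum h1
    rw [Finset.sum_add_distrib, Finset.sum_const, Finset.sum_const, hG, nsmul_eq_mul,
      nsmul_eq_mul] at this
    exact this.trans (add_le_add le_rfl h2)
  have hf0 : ((k + 1).factorial : ENNReal) ≠ 0 := by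
    exact_mod_cast (Nat.factorial_pos _).ne'
  have hft : ((k + 1).factorial : ENNReal) ≠ ⊤ := ENNReal.natCast_ne_top _
  have hk0 : ((k + 1 : ℕ) : ENNReal) ≠ 0 := by exact_mod_cast (Nat.succ_ne_zero k)
  have hkt : ((k + 1 : ℕ) : ENNReal) ≠ ⊤ := ENNReal.natCast_ne_top _
  rw [← ENNReal.mul_le_mul_iff_right hf0 hft]
  refine h3.trans (le_of_eq ?_)
  rw [mul_add ((k + 1).factorial : ENNReal)]
  congr 1
  rw [Nat.factorial_succ, Nat.cast_mul]
  calc _ = (((k + 1 : ℕ) : ENNReal) * ((k + 1 : ℕ) : ENNReal)⁻¹) * ((k.factorial : ENNReal) *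
        (1 + (n : ENNReal) * n * ENNReal.ofReal δ)) := by
        rw [ENNReal.mul_inv_cancel hk0 hkt, one_mul]
    _ = _ := by ring

lemma subset_Ev (hn : 2 ≤ n) (δ : ℝ) : {C | ZATSP n C - ZAP n C ≤ δ} ⊆ Ev δ 1 := by
  intro C hC
  have hfin : {x | ∃ π : Equiv.Perm (Fin n), IsCyclicPerm π ∧ x = permCost C π}.Finite := by
    refine (Set.finite_range (fun π : Equiv.Perm (Fin n) => permCost C π)).subset ?_
    rintro x ⟨π, -, rfl⟩
    exact ⟨π, rfl⟩
  have hfin' : {x | ∃ π : Equiv.Perm (Fin n), IsDerangement π ∧ x = permCost C π}.Finite := by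
    refine (Set.finite_range (fun π : Equiv.Perm (Fin n) => permCost C π)).subset ?_
    rintro x ⟨π, -, rfl⟩
    exact ⟨π, rfl⟩
  obtain ⟨p, hp⟩ := exists_cyclic hn
  obtain ⟨π, hπ, hx⟩ := Set.Nonempty.csInf_mem
    (s := {x | ∃ π : Equiv.Perm (Fin n), IsCyclicPerm π ∧ x = permCost C π}) ⟨_, p, hp, rfl⟩ hfin
  refine ⟨π, ⟨fun i => by simpa using hπ.2 i, fun π' h' => ?_⟩, by simpa using hπ⟩
  have h1 : ZAP n C ≤ permCost C π' :=
    csInf_le hfin'.bddBelow ⟨π', fun i => by simpa [Feas] using h' i, rfl⟩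
  have h2 : ZATSP n C = permCost C π := hx
  have h3 : ZATSP n C - ZAP n C ≤ δ := hC
  linarith

lemma final_bound (hn : 2 ≤ n) :
    costMeasure n {C | ZATSP n C - ZAP n C ≤ (n : ℝ) ^ (-(3 : ℝ) / 2)} ≤
      ENNReal.ofReal (14 * (n : ℝ) ^ (-(1 / 4) : ℝ)) := by
  have hnR : (2 : ℝ) ≤ n := by exact_mod_cast hn
  have hn0 : (0 : ℝ) < n := by linarith
  have hn1 : (1 : ℝ) ≤ n := by linarith
  set δ : ℝ := (n : ℝ) ^ (-(3 : ℝ) / 2) with hδ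
  have hδ0 : 0 ≤ δ := by positivity
  set q : ℝ := (n : ℝ) ^ (3 / 4 : ℝ) with hq
  have hq1 : 1 ≤ q := Real.one_le_rpow hn1 (by norm_num)
  have hqn : q ≤ n := by
    calc q ≤ (n : ℝ) ^ (1 : ℝ) := Real.rpow_le_rpow_of_exponent_le hn1 (by norm_num)
      _ = n := Real.rpow_one _
  obtain ⟨k, hk⟩ : ∃ k, ⌈q⌉₊ = k + 1 :=
    ⟨⌈q⌉₊ - 1, by have : 0 < ⌈q⌉₊ := Nat.ceil_pos.2 (by linarith); omega⟩
  have hkn : k + 1 ≤ n := by rw [← hk]; exact Nat.ceil_le.2 hqn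
  have hk1 : q ≤ ((k + 1 : ℕ) : ℝ) := by rw [← hk]; exact Nat.le_ceil q
  have hk2 : ((k + 1 : ℕ) : ℝ) ≤ 2 * q := by
    rw [← hk]
    have := Nat.ceil_lt_add_one (show 0 ≤ q by linarith)
    linarith
  refine (measure_mono (subset_Ev hn δ)).trans ((main_bound hn hδ0 k hkn).trans ?_)
  have hsub : ((n - 1 : ℕ) : ℝ) = n - 1 := by
    rw [Nat.cast_sub (by omega)]; simp
  have hn1pos : (0 : ℝ) < ((n - 1 : ℕ) : ℝ) := by rw [hsub]; linarith
  have hkpos : (0 : ℝ) < ((k + 1 : ℕ) : ℝ) := by linarith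
  have e1 : ((n - 1 : ℕ) : ENNReal)⁻¹ = ENNReal.ofReal (((n - 1 : ℕ) : ℝ)⁻¹) := by
    rw [ENNReal.ofReal_inv_of_pos hn1pos, ENNReal.ofReal_natCast]
  have e2 : ((k + 1 : ℕ) : ENNReal)⁻¹ = ENNReal.ofReal (((k + 1 : ℕ) : ℝ)⁻¹) := by
    rw [ENNReal.ofReal_inv_of_pos hkpos, ENNReal.ofReal_natCast]
  have e3 : ((k + 1 : ℕ) : ENNReal) * (2 * (((n - 1 : ℕ) : ENNReal)⁻¹ + ENNReal.ofReal δ)) +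
      (1 + (n : ENNReal) * n * ENNReal.ofReal δ) * ((k + 1 : ℕ) : ENNReal)⁻¹ =
      ENNReal.ofReal (((k + 1 : ℕ) : ℝ) * (2 * (((n - 1 : ℕ) : ℝ)⁻¹ + δ)) +
        (1 + (n : ℝ) * n * δ) * ((k + 1 : ℕ) : ℝ)⁻¹) := by
    rw [ENNReal.ofReal_add (by positivity) (by positivity), ENNReal.ofReal_mul (by positivity),
      ENNReal.ofReal_mul (by positivity), ENNReal.ofReal_add (by positivity) hδ0,
      ENNReal.ofReal_mul (by positivity), ENNReal.ofReal_add (by positivity) (by positivity),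
      ENNReal.ofReal_mul (by positivity), ENNReal.ofReal_mul (by positivity), e1, e2]
    simp only [ENNReal.ofReal_natCast, ENNReal.ofReal_one, ENNReal.ofReal_ofNat]
  rw [e3]
  refine ENNReal.ofReal_le_ofReal ?_
  set r : ℝ := (n : ℝ) ^ (-(1 / 4) : ℝ) with hr
  have hr0 : 0 < r := by positivity
  have hinv : ((n - 1 : ℕ) : ℝ)⁻¹ ≤ 2 * (n : ℝ)⁻¹ := by
    rw [hsub, ← div_eq_mul_inv, inv_eq_one_div, div_le_div_iff₀ (by linarith) hn0]
    linarith
  have hδn : δ ≤ (n : ℝ)⁻¹ := by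
    rw [← Real.rpow_neg_one, hδ]
    exact Real.rpow_le_rpow_of_exponent_le hn1 (by norm_num)
  have hqr : q * (n : ℝ)⁻¹ = r := by
    rw [← Real.rpow_neg_one, hq, hr, ← Real.rpow_add hn0]; norm_num
  have hnd : (n : ℝ) * n * δ = (n : ℝ) ^ (1 / 2 : ℝ) := by
    have : (n : ℝ) * n = (n : ℝ) ^ (2 : ℝ) := by rw [Real.rpow_two]; ring
    rw [this, hδ, ← Real.rpow_add hn0]; norm_num
  have hh : 1 ≤ (n : ℝ) ^ (1 / 2 : ℝ) := Real.one_le_rpow hn1 (by norm_num)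
  have hhq : (n : ℝ) ^ (1 / 2 : ℝ) * q⁻¹ = r := by
    rw [hq, hr, ← Real.rpow_neg hn0.le, ← Real.rpow_add hn0]; norm_num
  have p1 : ((k + 1 : ℕ) : ℝ) * (2 * (((n - 1 : ℕ) : ℝ)⁻¹ + δ)) ≤
      (2 * q) * (2 * (2 * (n : ℝ)⁻¹ + (n : ℝ)⁻¹)) := by gcongr
  have p2 : (1 + (n : ℝ) * n * δ) * ((k + 1 : ℕ) : ℝ)⁻¹ ≤
      (2 * (n : ℝ) ^ (1 / 2 : ℝ)) * q⁻¹ := by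
    rw [hnd]
    gcongr
    linarith
  have p3 : (2 * q) * (2 * (2 * (n : ℝ)⁻¹ + (n : ℝ)⁻¹)) = 12 * (q * (n : ℝ)⁻¹) := by ring
  have p4 : (2 * (n : ℝ) ^ (1 / 2 : ℝ)) * q⁻¹ = 2 * ((n : ℝ) ^ (1 / 2 : ℝ) * q⁻¹) := by ring
  rw [p3, hqr] at p1
  rw [p4, hhq] at p2
  linarith

end Prob

end Pf

/-- `P(Z_ATSP − Z_AP ≤ n^{−3/2}) → 0` as `n → ∞`. -/
theorem statement_1 :
    Filter.Tendsto
      (fun n : ℕ => costMeasure n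
        {C | ZATSP n C - ZAP n C ≤ (n : ℝ) ^ (-(3 : ℝ) / 2)})
      Filter.atTop (nhds 0) := by
  have hlim : Filter.Tendsto (fun n : ℕ => ENNReal.ofReal (14 * (n : ℝ) ^ (-(1 / 4) : ℝ)))
      Filter.atTop (nhds 0) := by
    have h1 : Filter.Tendsto (fun n : ℕ => 14 * (n : ℝ) ^ (-(1 / 4) : ℝ))
        Filter.atTop (nhds (14 * 0)) :=
      ((tendsto_rpow_neg_atTop (by norm_num : (0 : ℝ) < 1 / 4)).comp
        tendsto_natCast_atTop_atTop).const_mul 14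
    have h2 := ENNReal.tendsto_ofReal h1
    simpa using h2
  refine tendsto_of_tendsto_of_tendsto_of_le_of_le' tendsto_const_nhds hlim
    (Filter.Eventually.of_forall fun n => bot_le) ?_
  filter_upwards [Filter.eventually_ge_atTop 2] with n hn
  exact Pf.final_bound hn
end

section
/- Let ε > 0 be a sufficiently small constant, let n be sufficiently large, and set ζ = ⌈n^ε⌉ and γ_ε = 30ζ/(εn). For every fixed constraint pair F = (F0, F1) satisfying condition (⋆), with probability at least 1 − n·e^{−ζ} (over the random cost matrix C) there exist real numbers (u_i)_{i∈A_F} and (v_j)_{j∈B_F} such that u_i + v_j ≤ C(i,j) for every (i,j) ∈ Ω_F, Σ_{i∈A_F} u_i + Σ_{j∈B_F} v_j equals the minimum cost of a perfect matching between A_F and B_F using only pairs in Ω_F, and |u_i| ≤ 2γ_ε and |v_j| ≤ 2γ_ε for all i ∈ A_F, j ∈ B_F. -/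
open MeasureTheory Finset

/-- The rows not saturated by `F1`. -/
def AF {n : ℕ} (F1 : Finset (Fin n × Fin n)) : Finset (Fin n) :=
  Finset.univ.filter fun i => ∀ j : Fin n, (i, j) ∉ F1

/-- The columns not saturated by `F1`. -/
def BF {n : ℕ} (F1 : Finset (Fin n × Fin n)) : Finset (Fin n) :=
  Finset.univ.filter fun j => ∀ i : Fin n, (i, j) ∉ F1

/-- The available pairs `Ω_F = (A_F × B_F) \ (F0 ∪ F̂0 ∪ D)`. -/
def OmegaF {n : ℕ} (F0 F1 : Finset (Fin n × Fin n)) : Set (Fin n × Fin n) :=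
  {p | p.1 ∈ AF F1 ∧ p.2 ∈ BF F1 ∧ p ∉ F0 ∧ p ∉ Fhat0 F1 ∧ p.1 ≠ p.2}

/-- The minimum cost of a perfect matching between `A_F` and `B_F` using only
pairs in `Ω_F`. -/
noncomputable def minMatchCost {n : ℕ} (C : Fin n × Fin n → ℝ)
    (F0 F1 : Finset (Fin n × Fin n)) : ℝ :=
  sInf {x | ∃ σ : Fin n → Fin n, Set.BijOn σ (AF F1) (BF F1) ∧
    (∀ i ∈ AF F1, (i, σ i) ∈ OmegaF F0 F1) ∧ x = ∑ i ∈ AF F1, C (i, σ i)}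


theorem dual_max {α β : Type*} [Fintype α] [Fintype β] [Nonempty α] [Nonempty β]
    (hcard : Fintype.card α = Fintype.card β) (c : α → β → ℝ) :
    ∃ u : α → ℝ, ∃ v : β → ℝ, (∀ i j, u i + v j ≤ c i j) ∧
      ∀ (u' : α → ℝ) (v' : β → ℝ), (∀ i j, u' i + v' j ≤ c i j) →
        ∑ i, u' i + ∑ j, v' j ≤ ∑ i, u i + ∑ j, v j := by
  obtain ⟨M, hM⟩ : ∃ M : ℝ, ∀ i j, |c i j| ≤ M := by
    obtain ⟨M, hM⟩ := (Set.finite_range (fun p : α × β => |c p.1 p.2|)).bddAbove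
    exact ⟨M, fun i j => hM ⟨(i, j), rfl⟩⟩
  have hM0 : 0 ≤ M := (abs_nonneg _).trans (hM (Classical.arbitrary α) (Classical.arbitrary β))
  let K : Set ((α → ℝ) × (β → ℝ)) :=
    (Set.Icc (fun _ => -(3 * M)) (fun _ => 3 * M) ×ˢ Set.Icc (fun _ => -(3 * M)) (fun _ => 3 * M)) ∩
      {w | ∀ i j, w.1 i + w.2 j ≤ c i j}
  have hK : IsCompact K := by
    apply IsCompact.inter_right
    · exact isCompact_Icc.prod isCompact_Icc
    · simp only [Set.ofPred_forall]
      refine isClosed_iInter fun i => isClosed_iInter fun j => ?_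
      exact isClosed_le (by fun_prop) continuous_const
  have hne : K.Nonempty := by
    refine ⟨(fun _ => -M, fun _ => 0), ⟨⟨⟨fun _ => ?_, fun _ => ?_⟩, ⟨fun _ => ?_, fun _ => ?_⟩⟩, fun i j => ?_⟩⟩
    all_goals simp only
    all_goals try linarith
    have := abs_le.1 (hM i j); linarith
  obtain ⟨w, hwK, hw⟩ := hK.exists_isMaxOn hne
    (f := fun w => ∑ i, w.1 i + ∑ j, w.2 j) (by fun_prop)
  refine ⟨w.1, w.2, hwK.2, fun u' v' h => ?_⟩
  let u1 : α → ℝ := fun i => univ.inf' univ_nonempty (fun j => c i j - v' j)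
  let v1 : β → ℝ := fun j => univ.inf' univ_nonempty (fun i => c i j - u1 i)
  have hu1 : ∀ i j, u1 i ≤ c i j - v' j := fun i j => inf'_le _ (mem_univ j)
  have hv1 : ∀ i j, v1 j ≤ c i j - u1 i := fun i j => inf'_le _ (mem_univ i)
  have hu : ∀ i, u' i ≤ u1 i := fun i => le_inf' _ _ fun j _ => by linarith [h i j]
  have hv : ∀ j, v' j ≤ v1 j := fun j => le_inf' _ _ fun i _ => by linarith [hu1 i j]
  let j0 := Classical.arbitrary β
  have hosc : ∀ j j', v1 j - v1 j' ≤ 2 * M := by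
    intro j j'
    obtain ⟨i, -, hi⟩ := exists_mem_eq_inf' (univ_nonempty (α := α)) (fun i => c i j' - u1 i)
    have : v1 j' = c i j' - u1 i := hi
    have := hv1 i j
    have := abs_le.1 (hM i j); have := abs_le.1 (hM i j')
    linarith
  have hlow : ∀ i, ∃ j, c i j - v1 j ≤ u1 i := by
    intro i
    obtain ⟨j, -, hj⟩ := exists_mem_eq_inf' (univ_nonempty (α := β)) (fun j => c i j - v' j)
    have : u1 i = c i j - v' j := hj
    exact ⟨j, by linarith [hv j]⟩
  have hmem : ((fun i => u1 i + v1 j0, fun j => v1 j - v1 j0) : (α → ℝ) × (β → ℝ)) ∈ K := by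
    refine ⟨⟨⟨fun i => ?_, fun i => ?_⟩, ⟨fun j => ?_, fun j => ?_⟩⟩, fun i j => ?_⟩
    all_goals simp only
    · obtain ⟨j, hj⟩ := hlow i
      have := hosc j j0; have := abs_le.1 (hM i j); linarith
    · have := hv1 i j0; have := abs_le.1 (hM i j0); linarith
    · have := hosc j0 j; linarith
    · have := hosc j j0; linarith
    · have := hv1 i j; linarith
  have h2 := hw hmem
  simp only [Set.mem_ofPred_eq, sum_add_distrib, sum_sub_distrib, sum_const, card_univ, nsmul_eq_mul, hcard] at h2
  have h3 : ∑ i, u' i ≤ ∑ i, u1 i := sum_le_sum fun i _ => hu i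
  have h4 : ∑ i, v' i ≤ ∑ i, v1 i := sum_le_sum fun i _ => hv i
  linarith

theorem dual_exists {α β : Type*} [Fintype α] [Fintype β]
    (hcard : Fintype.card α = Fintype.card β) (c : α → β → ℝ) :
    ∃ u : α → ℝ, ∃ v : β → ℝ, ∃ e : α ≃ β, (∀ i j, u i + v j ≤ c i j) ∧
      ∀ i, u i + v (e i) = c i (e i) := by
  classical
  rcases isEmpty_or_nonempty α with hα | hα
  · exact ⟨fun _ => 0, fun _ => 0, Fintype.equivOfCardEq hcard, fun i => hα.elim i, fun i => hα.elim i⟩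
  have : Nonempty β := (Fintype.equivOfCardEq hcard).nonempty_congr.1 hα
  obtain ⟨u, v, huv, hmax⟩ := dual_max hcard c
  let t : α → Finset β := fun i => univ.filter fun j => u i + v j = c i j
  have hall : ∀ S : Finset α, #S ≤ #(S.biUnion t) := by
    by_contra! hcon
    obtain ⟨S, hS⟩ := hcon
    obtain ⟨η, hη0, hη⟩ : ∃ η : ℝ, 0 < η ∧ ∀ i j, u i + v j < c i j → η ≤ c i j - (u i + v j) := by
      have hfin : ∀ s : Finset (α × β), ∃ η : ℝ, 0 < η ∧ ∀ p ∈ s, u p.1 + v p.2 < c p.1 p.2 →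
          η ≤ c p.1 p.2 - (u p.1 + v p.2) := by
        intro s
        induction s using Finset.induction_on with
        | empty => exact ⟨1, one_pos, by simp⟩
        | insert a s _ ih =>
          obtain ⟨η, h0, h⟩ := ih
          by_cases ha : u a.1 + v a.2 < c a.1 a.2
          · refine ⟨min η (c a.1 a.2 - (u a.1 + v a.2)), lt_min h0 (by linarith), ?_⟩
            intro p hp hlt
            rcases mem_insert.1 hp with rfl | hp
            · exact min_le_right _ _
            · exact (min_le_left _ _).trans (h p hp hlt)
          · refine ⟨η, h0, ?_⟩
            intro p hp hlt
            rcases mem_insert.1 hp with rfl | hp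
            · exact absurd hlt ha
            · exact h p hp hlt
      obtain ⟨η, h0, h⟩ := hfin univ
      exact ⟨η, h0, fun i j => h (i, j) (mem_univ _)⟩
    have h1 := hmax (fun i => u i + if i ∈ S then η else 0)
      (fun j => v j + if j ∈ S.biUnion t then -η else 0) (by
        intro i j
        have h0 := huv i j
        by_cases hi : i ∈ S
        · by_cases hj : j ∈ S.biUnion t
          · simp only [hi, hj, if_true]; linarith
          · have : u i + v j ≠ c i j := fun h => hj (mem_biUnion.2 ⟨i, hi, by simp [t, h]⟩)
            have := hη i j (lt_of_le_of_ne h0 this)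
            simp only [hi, hj, if_true, if_false]; linarith
        · by_cases hj : j ∈ S.biUnion t
          · simp only [hi, hj, if_true, if_false]; linarith
          · simp only [hi, hj, if_false]; linarith)
    simp only [sum_add_distrib, sum_ite_mem, univ_inter, sum_const, nsmul_eq_mul] at h1
    have h2 : (#(S.biUnion t) : ℝ) < #S := by exact_mod_cast hS
    nlinarith
  obtain ⟨f, hf, hft⟩ := (all_card_le_biUnion_card_iff_exists_injective t).1 hall
  have hb : Function.Bijective f := (Fintype.bijective_iff_injective_and_card f).2 ⟨hf, hcard⟩
  refine ⟨u, v, Equiv.ofBijective f hb, huv, fun i => ?_⟩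
  have := hft i
  simpa [t] using this

/-- Level sets of the dual variables grow. -/
theorem growth {α β : Type*} [Fintype α] [Fintype β] (e : α ≃ β) (u : α → ℝ) (v : β → ℝ)
    (Gr : α → β → Prop) (δ : ℝ) (r q : ℕ) (hδ : 0 ≤ δ) (h1 : ∀ i, 0 ≤ u i + v (e i))
    (h2 : ∀ i j, Gr i j → u i + v j ≤ δ)
    (hexp : ∀ S : Finset α, S.Nonempty → ∀ X : Finset β, (∀ i ∈ S, ∀ j, Gr i j → j ∈ X) →
      r * #S < #X ∨ q < 3 * #X)
    (i0 : α) (t : ℕ) :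
    r ^ t ≤ #(univ.filter fun i => u i0 - t * δ ≤ u i) ∨
      q < 3 * #(univ.filter fun i => u i0 - t * δ ≤ u i) := by
  classical
  induction t with
  | zero =>
    left
    simp only [pow_zero]
    exact card_pos.2 ⟨i0, by simp⟩
  | succ t ih =>
    have hmono : #(univ.filter fun i => u i0 - t * δ ≤ u i) ≤
        #(univ.filter fun i => u i0 - (t + 1 : ℕ) * δ ≤ u i) := by
      apply card_le_card
      intro i
      simp only [mem_filter, mem_univ, true_and]
      intro h; push_cast; linarith
    rcases ih with ih | ih
    swap
    · right; omega
    have hS : (univ.filter fun i => u i0 - t * δ ≤ u i).Nonempty :=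
      ⟨i0, by simp; positivity⟩
    have := hexp _ hS ((univ.filter fun i => u i0 - (t + 1 : ℕ) * δ ≤ u i).map e.toEmbedding) (by
      intro i hi j hij
      rw [mem_map_equiv]
      simp only [mem_filter, mem_univ, true_and] at hi ⊢
      have a1 := h1 (e.symm j)
      rw [e.apply_symm_apply] at a1
      have a2 := h2 i j hij
      push_cast; linarith)
    rw [card_map] at this
    rcases this with h | h
    · left
      rw [pow_succ, mul_comm]
      exact (Nat.mul_le_mul_left r ih).trans h.le
    · exact Or.inr h

/-- All the sums of dual variables are small. -/
theorem dual_small {α β : Type*} [Fintype α] [Fintype β] (e : α ≃ β) (u : α → ℝ) (v : β → ℝ)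
    (Gr : α → β → Prop) (δ : ℝ) (r q t : ℕ) (hδ : 0 ≤ δ) (h1 : ∀ i, 0 ≤ u i + v (e i))
    (h2 : ∀ i j, Gr i j → u i + v j ≤ δ)
    (hexp : ∀ S : Finset α, S.Nonempty → ∀ X : Finset β, (∀ i ∈ S, ∀ j, Gr i j → j ∈ X) →
      r * #S < #X ∨ q < 3 * #X)
    (hexp' : ∀ S : Finset β, S.Nonempty → ∀ X : Finset α, (∀ j ∈ S, ∀ i, Gr i j → i ∈ X) →
      r * #S < #X ∨ q < 3 * #X)
    (hr : 1 ≤ r) (hrt : Fintype.card α ≤ r ^ t) (hq : q < 3 * Fintype.card α)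
    (hq2 : 3 * Fintype.card α ≤ 2 * q) (i0 : α) (j0 : β) :
    u i0 + v j0 ≤ (2 * t + 1) * δ := by
  classical
  have hc : Fintype.card α = Fintype.card β := Fintype.card_congr e
  have g1 : q < 3 * #(univ.filter fun i => u i0 - t * δ ≤ u i) := by
    rcases growth e u v Gr δ r q hδ h1 h2 hexp i0 t with h | h
    · omega
    · exact h
  have g2 : q < 3 * #(univ.filter fun j => v j0 - t * δ ≤ v j) := by
    rcases growth e.symm v u (fun j i => Gr i j) δ r q hδ
      (fun j => by have := h1 (e.symm j); rw [e.apply_symm_apply] at this; linarith)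
      (fun j i h => by linarith [h2 i j h]) hexp' j0 t with h | h
    · omega
    · exact h
  set S := univ.filter fun i => u i0 - t * δ ≤ u i with hS
  set T := univ.filter fun j => v j0 - t * δ ≤ v j with hT
  have hSne : S.Nonempty := ⟨i0, by simp [hS]; positivity⟩
  let X : Finset β := univ.filter fun j => ∃ i ∈ S, Gr i j
  have hX : q < 3 * #X := by
    rcases hexp S hSne X (fun i hi j h => by simp [X]; exact ⟨i, hi, h⟩) with h | h
    · have : #S ≤ r * #S := Nat.le_mul_of_pos_left _ hr
      omega
    · exact h
  obtain ⟨j, hj⟩ : (X ∩ T).Nonempty := by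
    rw [← card_pos]
    have := card_union_add_card_inter X T
    have : #(X ∪ T) ≤ Fintype.card β := card_le_univ _
    omega
  rw [mem_inter] at hj
  obtain ⟨i, hi, hij⟩ : ∃ i ∈ S, Gr i j := by simpa [X] using hj.1
  have a1 : u i0 - t * δ ≤ u i := by simpa [hS] using hi
  have a2 : v j0 - t * δ ≤ v j := by simpa [hT] using hj.2
  have a3 := h2 i j hij
  linarith

theorem prob_avoid (n : ℕ) (P : Finset (Fin n × Fin n)) (δ : ℝ) :
    costMeasure n {C | ∀ p ∈ P, δ < C p} ≤ ENNReal.ofReal (Real.exp (-δ * #P)) := by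
  classical
  have hset : {C : Fin n × Fin n → ℝ | ∀ p ∈ P, δ < C p} =
      Set.pi Set.univ (fun p => if p ∈ P then Set.Ioi δ else Set.univ) := by
    ext C
    simp only [Set.mem_ofPred_eq, Set.mem_pi, Set.mem_univ, true_imp_iff]
    refine forall_congr' fun p => ?_
    split_ifs with h <;> simp [h]
  rw [hset, costMeasure, Measure.pi_pi]
  have hle : ∀ p : Fin n × Fin n, (volume.restrict (Set.Icc (0:ℝ) 1))
      (if p ∈ P then Set.Ioi δ else Set.univ) ≤
      if p ∈ P then ENNReal.ofReal (Real.exp (-δ)) else 1 := by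
    intro p
    split_ifs
    · rw [Measure.restrict_apply measurableSet_Ioi]
      calc volume (Set.Ioi δ ∩ Set.Icc (0:ℝ) 1) ≤ volume (Set.Ioc δ 1) :=
            measure_mono fun x hx => ⟨hx.1, hx.2.2⟩
        _ = ENNReal.ofReal (1 - δ) := Real.volume_Ioc
        _ ≤ _ := ENNReal.ofReal_le_ofReal (by linarith [Real.add_one_le_exp (-δ)])
    · simp
  refine (prod_le_prod' fun p _ => hle p).trans ?_
  rw [prod_ite_mem, univ_inter, prod_const, ← ENNReal.ofReal_pow (Real.exp_pos _).le,
    ← Real.exp_nat_mul]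
  apply le_of_eq; congr 2; ring

theorem prob_neg (n : ℕ) (p : Fin n × Fin n) :
    costMeasure n {C | C p < 0} = 0 := by
  classical
  have hset : {C : Fin n × Fin n → ℝ | C p < 0} =
      Set.pi Set.univ (fun p' => if p' = p then Set.Iio 0 else Set.univ) := by
    ext C
    simp only [Set.mem_ofPred_eq, Set.mem_pi, Set.mem_univ, true_imp_iff]
    constructor
    · intro h p'
      split_ifs with hpp
      · subst hpp; exact h
      · trivial
    · intro h; simpa using h p
  rw [hset, costMeasure, Measure.pi_pi]
  refine prod_eq_zero (mem_univ p) ?_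
  rw [if_pos rfl, Measure.restrict_apply measurableSet_Iio]
  have : Set.Iio (0:ℝ) ∩ Set.Icc 0 1 = ∅ := by
    ext x; simp only [Set.mem_inter_iff, Set.mem_Iio, Set.mem_Icc, Set.mem_empty_iff_false, iff_false]
    intro h; linarith [h.1, h.2.1]
  rw [this, measure_empty]

theorem sum_bound (n r : ℕ) (hn : 1 ≤ n) (A B : Finset (Fin n)) (y : ℝ) (hy : 0 ≤ y)
    (hq : n * (y * (n:ℝ) ^ r) ≤ 1) :
    ∑ w ∈ (A.powerset ×ˢ B.powerset).filter (fun w => w.1.Nonempty ∧ #w.2 ≤ r * #w.1),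
      y ^ #w.1 ≤ 6 * (n * (y * (n:ℝ) ^ r)) := by
  have hn0 : (0:ℝ) < n := by exact_mod_cast hn
  set q := y * (n:ℝ) ^ r with hqdef
  have hq0 : 0 ≤ q := by positivity
  calc ∑ w ∈ (A.powerset ×ˢ B.powerset).filter (fun w => w.1.Nonempty ∧ #w.2 ≤ r * #w.1), y ^ #w.1
      ≤ ∑ w ∈ (A.powerset ×ˢ B.powerset).filter (fun w => w.1.Nonempty ∧ #w.2 ≤ r * #w.1),
        q ^ #w.1 * (1 / (n:ℝ)) ^ #w.2 := by
        refine sum_le_sum fun w hw => ?_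
        have h := (mem_filter.1 hw).2.2
        rw [hqdef, mul_pow, ← pow_mul, mul_assoc]
        refine le_mul_of_one_le_right (by positivity) ?_
        rw [one_div, inv_pow, ← div_eq_mul_inv, one_le_div (by positivity)]
        exact pow_le_pow_right₀ (by exact_mod_cast hn) h
    _ ≤ ∑ w ∈ (A.powerset.erase ∅) ×ˢ B.powerset, q ^ #w.1 * (1 / (n:ℝ)) ^ #w.2 := by
        refine sum_le_sum_of_subset_of_nonneg ?_ (fun _ _ _ => by positivity)
        intro w
        simp only [mem_filter, mem_product, mem_erase, nonempty_iff_ne_empty]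
        tauto
    _ = (∑ S ∈ A.powerset.erase ∅, q ^ #S) * ∑ X ∈ B.powerset, (1 / (n:ℝ)) ^ #X := by
        rw [sum_mul_sum, sum_product]
    _ = ((q + 1) ^ #A - 1) * (1 / (n:ℝ) + 1) ^ #B := by
        congr 1
        · rw [eq_sub_iff_add_eq, ← sum_pow_mul_eq_add_pow]
          simp only [one_pow, mul_one]
          have := sum_erase_add A.powerset (fun S => q ^ #S) (empty_mem_powerset A)
          simpa using this
        · rw [← sum_pow_mul_eq_add_pow]; simp
    _ ≤ (2 * (n * q)) * 3 := by
        have hA : #A ≤ n := by simpa using card_le_univ A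
        have hB : #B ≤ n := by simpa using card_le_univ B
        have e1 : (q + 1) ^ #A ≤ Real.exp (n * q) := by
          calc (q + 1) ^ #A ≤ (q+1) ^ n := pow_le_pow_right₀ (by linarith) hA
            _ ≤ (Real.exp q) ^ n := pow_le_pow_left₀ (by linarith) (Real.add_one_le_exp q) n
            _ = _ := by rw [← Real.exp_nat_mul]
        have e2 : (1 / (n:ℝ) + 1) ^ #B ≤ 3 := by
          calc (1 / (n:ℝ) + 1) ^ #B ≤ (1 / (n:ℝ) + 1) ^ n :=
                pow_le_pow_right₀ (by linarith [show (0:ℝ) ≤ 1 / n by positivity]) hB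
            _ ≤ (Real.exp (1 / (n:ℝ))) ^ n := pow_le_pow_left₀ (by positivity) (Real.add_one_le_exp _) n
            _ = Real.exp 1 := by rw [← Real.exp_nat_mul]; congr 1; field_simp
            _ ≤ 3 := by linarith [Real.exp_one_lt_d9]
        have e3 : Real.exp (n * q) - 1 ≤ 2 * (n * q) := by
          have h0 : 0 ≤ n * q := by positivity
          have := Real.abs_exp_sub_one_le (x := n * q) (by rw [abs_of_nonneg h0]; exact hq)
          rw [abs_of_nonneg h0] at this
          exact (le_abs_self _).trans this
        exact mul_le_mul (by linarith) e2 (by positivity) (by positivity)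
    _ = 6 * (n * q) := by ring

theorem prob_bad (n r : ℕ) (hn : 1 ≤ n) (A B : Finset (Fin n)) (φ : Fin n × Fin n → Fin n × Fin n)
    (hφ : Function.Injective φ) (Good : Set (Fin n × Fin n)) (d : ℕ) (hd : 12 * d ≤ n)
    (hdeg : ∀ i ∈ A, ∃ N : Finset (Fin n), #N ≤ d ∧ ∀ j ∈ B, j ∉ N → φ (i, j) ∈ Good)
    (δ ζ : ℝ) (hζ : 0 ≤ ζ) (hδ : δ = 6 * ζ / n)
    (hq : n * (Real.exp (-(3 / 2) * ζ) * (n:ℝ) ^ r) ≤ 1) :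
    costMeasure n {C | ∃ S ⊆ A, ∃ X ⊆ B, S.Nonempty ∧ #X ≤ r * #S ∧ n ≤ 3 * #(B \ X) ∧
      ∀ i ∈ S, ∀ j ∈ B \ X, φ (i, j) ∈ Good → δ < C (φ (i, j))} ≤
      ENNReal.ofReal (6 * (n * (Real.exp (-(3 / 2) * ζ) * (n:ℝ) ^ r))) := by
  classical
  have hn0 : (0:ℝ) < n := by exact_mod_cast hn
  set I := (A.powerset ×ˢ B.powerset).filter (fun w => w.1.Nonempty ∧ #w.2 ≤ r * #w.1) with hI
  let E : Finset (Fin n) × Finset (Fin n) → Set (Fin n × Fin n → ℝ) := fun w =>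
    {C | n ≤ 3 * #(B \ w.2) ∧ ∀ i ∈ w.1, ∀ j ∈ B \ w.2, φ (i, j) ∈ Good → δ < C (φ (i, j))}
  have hE : ∀ w ∈ I, costMeasure n (E w) ≤ ENNReal.ofReal (Real.exp (-(3 / 2) * ζ) ^ #w.1) := by
    intro w hw
    simp only [hI, mem_filter, mem_product, mem_powerset] at hw
    by_cases hc : n ≤ 3 * #(B \ w.2)
    swap
    · have : E w = ∅ := by ext C; simp [E, hc]
      rw [this, measure_empty]; exact zero_le
    let P : Finset (Fin n × Fin n) :=
      ((w.1 ×ˢ (B \ w.2)).filter fun p => φ p ∈ Good).image φ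
    have hsub : E w ⊆ {C | ∀ p ∈ P, δ < C p} := by
      intro C hC p hp
      simp only [P, mem_image, mem_filter, mem_product] at hp
      obtain ⟨⟨i, j⟩, ⟨⟨hi, hj⟩, hg⟩, rfl⟩ := hp
      exact hC.2 i hi j hj hg
    refine (measure_mono hsub).trans ((prob_avoid n P δ).trans ?_)
    apply ENNReal.ofReal_le_ofReal
    rw [← Real.exp_nat_mul, Real.exp_le_exp]
    have hcard : n * #w.1 ≤ 4 * #P := by
      rw [card_image_of_injective _ hφ, card_filter, sum_product]
      have : ∀ i ∈ w.1, n ≤ 4 * ∑ j ∈ B \ w.2, if φ (i, j) ∈ Good then 1 else 0 := by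
        intro i hi
        rw [← card_filter]
        obtain ⟨N, hN, hN2⟩ := hdeg i (hw.1.1 hi)
        have h1 : #((B \ w.2) \ N) ≤ #((B \ w.2).filter fun j => φ (i, j) ∈ Good) := by
          apply card_le_card
          intro j hj
          simp only [mem_sdiff, mem_filter] at hj ⊢
          exact ⟨hj.1, hN2 j hj.1.1 hj.2⟩
        have h2 := le_card_sdiff N (B \ w.2)
        omega
      calc n * #w.1 = ∑ i ∈ w.1, n := by rw [sum_const, smul_eq_mul, mul_comm]
        _ ≤ _ := sum_le_sum this
        _ = _ := by rw [mul_sum]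
    have hcard' : (n:ℝ) * #w.1 ≤ 4 * #P := by exact_mod_cast hcard
    have : (3/2) * ζ * #w.1 ≤ δ * #P := by
      rw [hδ, div_mul_eq_mul_div (6 * ζ), le_div_iff₀ hn0]
      nlinarith
    linarith
  have hsub : {C : Fin n × Fin n → ℝ | ∃ S ⊆ A, ∃ X ⊆ B, S.Nonempty ∧ #X ≤ r * #S ∧ n ≤ 3 * #(B \ X) ∧
      ∀ i ∈ S, ∀ j ∈ B \ X, φ (i, j) ∈ Good → δ < C (φ (i, j))} ⊆ ⋃ w ∈ I, E w := by
    rintro C ⟨S, hS, X, hX, h1, h2, h3, h4⟩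
    simp only [Set.mem_iUnion]
    exact ⟨(S, X), by simp [hI, hS, hX, h1, h2], h3, h4⟩
  calc _ ≤ costMeasure n (⋃ w ∈ I, E w) := measure_mono hsub
    _ ≤ ∑ w ∈ I, costMeasure n (E w) := measure_biUnion_finset_le _ _
    _ ≤ ∑ w ∈ I, ENNReal.ofReal (Real.exp (-(3 / 2) * ζ) ^ #w.1) := sum_le_sum hE
    _ = ENNReal.ofReal (∑ w ∈ I, Real.exp (-(3 / 2) * ζ) ^ #w.1) := by
        rw [ENNReal.ofReal_sum_of_nonneg]; intros; positivity
    _ ≤ _ := ENNReal.ofReal_le_ofReal (sum_bound n r hn A B _ (Real.exp_pos _).le hq)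

theorem mem_Omega {n : ℕ} {F0 F1 : Finset (Fin n × Fin n)} (hF : IsConstraint F0 F1) {i j : Fin n}
    (hi : i ∈ AF F1) (hj : j ∈ BF F1) (hij : i ≠ j) (h0 : (i, j) ∉ F0)
    (h : j ∈ AF F1 ∨ i ∈ BF F1) : (i, j) ∈ OmegaF F0 F1 := by
  refine ⟨hi, hj, h0, ?_, hij⟩
  rintro ⟨-, -, hnv⟩
  simp only [AF, BF, mem_filter, mem_univ, true_and] at hi hj h
  obtain ⟨-, -, hv1, hv2, hv3⟩ := hF
  apply hnv
  refine ⟨?_, ?_, ?_⟩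
  · rintro e (rfl | he) e' (rfl | he') hee
    · rfl
    · exact absurd (show (i, e'.2) ∈ F1 by simp only at hee; rw [hee]; exact he') (hi _)
    · exact absurd (show (i, e.2) ∈ F1 by simp only at hee; rw [← hee]; exact he) (hi _)
    · exact hv1 e he e' he' hee
  · rintro e (rfl | he) e' (rfl | he') hee
    · rfl
    · exact absurd (show (e'.1, j) ∈ F1 by simp only at hee; rw [hee]; exact he') (hj _)
    · exact absurd (show (e.1, j) ∈ F1 by simp only at hee; rw [← hee]; exact he) (hj _)
    · exact hv2 e he e' he' hee
  · intro k hk0 hkn f hf hall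
    refine hv3 k hk0 hkn f hf fun t => ?_
    rcases hall t with ht | ht
    swap
    · exact ht
    exfalso
    rw [Prod.mk.injEq] at ht
    rcases h with h | h
    · rcases hall (t + 1) with h' | h'
      · rw [Prod.mk.injEq] at h'
        exact hij (h'.1.symm.trans ht.2)
      · rw [ht.2] at h'; exact h _ h'
    · rcases hall (t - 1) with h' | h'
      · rw [Prod.mk.injEq, sub_add_cancel] at h'
        exact hij (ht.1.symm.trans h'.2)
      · rw [sub_add_cancel, ht.1] at h'; exact h _ h'

theorem card_AF {n : ℕ} {F0 F1 : Finset (Fin n × Fin n)} (hF : IsConstraint F0 F1) :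
    #(AF F1) + #F1 = n := by
  have h1 : AF F1 = univ \ F1.image Prod.fst := by
    ext i; simp [AF]
  have h2 : #(F1.image Prod.fst) = #F1 :=
    card_image_of_injOn fun e he e' he' h => hF.2.2.1 e he e' he' h
  rw [h1, ← h2, card_sdiff_add_card_eq_card (subset_univ _)]; simp

theorem card_BF {n : ℕ} {F0 F1 : Finset (Fin n × Fin n)} (hF : IsConstraint F0 F1) :
    #(BF F1) + #F1 = n := by
  have h1 : BF F1 = univ \ F1.image Prod.snd := by
    ext i; simp [BF]
  have h2 : #(F1.image Prod.snd) = #F1 :=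
    card_image_of_injOn fun e he e' he' h => hF.2.2.2.1 e he e' he' h
  rw [h1, ← h2, card_sdiff_add_card_eq_card (subset_univ _)]; simp

theorem deg_row {n : ℕ} {F0 F1 : Finset (Fin n × Fin n)} (hF : IsConstraint F0 F1) :
    ∀ i ∈ AF F1, ∃ N : Finset (Fin n), #N ≤ #F0 + #F1 + 1 ∧
      ∀ j ∈ BF F1, j ∉ N → (i, j) ∈ OmegaF F0 F1 := by
  intro i hi
  refine ⟨F0.image Prod.snd ∪ F1.image Prod.fst ∪ {i}, ?_, ?_⟩
  · have a1 := card_union_le (F0.image Prod.snd ∪ F1.image Prod.fst) {i}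
    have a2 := card_union_le (F0.image Prod.snd) (F1.image Prod.fst)
    have a3 := card_image_le (s := F0) (f := Prod.snd)
    have a4 := card_image_le (s := F1) (f := Prod.fst)
    rw [card_singleton] at a1
    omega
  · intro j hj hN
    simp only [mem_union, mem_image, mem_singleton, not_or, not_exists, not_and] at hN
    refine mem_Omega hF hi hj (fun h => hN.2 h.symm) (fun h => hN.1.1 _ h rfl) (Or.inl ?_)
    simp only [AF, mem_filter, mem_univ, true_and]
    exact fun k hk => hN.1.2 _ hk rfl

theorem deg_col {n : ℕ} {F0 F1 : Finset (Fin n × Fin n)} (hF : IsConstraint F0 F1) :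
    ∀ j ∈ BF F1, ∃ N : Finset (Fin n), #N ≤ #F0 + #F1 + 1 ∧
      ∀ i ∈ AF F1, i ∉ N → (i, j) ∈ OmegaF F0 F1 := by
  intro j hj
  refine ⟨F0.image Prod.fst ∪ F1.image Prod.snd ∪ {j}, ?_, ?_⟩
  · have a1 := card_union_le (F0.image Prod.fst ∪ F1.image Prod.snd) {j}
    have a2 := card_union_le (F0.image Prod.fst) (F1.image Prod.snd)
    have a3 := card_image_le (s := F0) (f := Prod.fst)
    have a4 := card_image_le (s := F1) (f := Prod.snd)
    rw [card_singleton] at a1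
    omega
  · intro i hi hN
    simp only [mem_union, mem_image, mem_singleton, not_or, not_exists, not_and] at hN
    refine mem_Omega hF hi hj (fun h => hN.2 h) (fun h => hN.1.1 _ h rfl) (Or.inr ?_)
    simp only [BF, mem_filter, mem_univ, true_and]
    exact fun k hk => hN.1.2 _ hk rfl

theorem expansion_subtype {n : ℕ} (r : ℕ) (A B : Finset (Fin n)) (φ : Fin n × Fin n → Fin n × Fin n)
    (Good : Set (Fin n × Fin n)) (δ : ℝ) (C : Fin n × Fin n → ℝ)
    (hB : n ≤ 3 * #B)
    (h : ¬ ∃ S ⊆ A, ∃ X ⊆ B, S.Nonempty ∧ #X ≤ r * #S ∧ n ≤ 3 * #(B \ X) ∧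
      ∀ i ∈ S, ∀ j ∈ B \ X, φ (i, j) ∈ Good → δ < C (φ (i, j)))
    (S : Finset {i // i ∈ A}) (hS : S.Nonempty) (X : Finset {j // j ∈ B})
    (hX : ∀ i ∈ S, ∀ j : {j // j ∈ B}, (φ (i.1, j.1) ∈ Good ∧ C (φ (i.1, j.1)) ≤ δ) → j ∈ X) :
    r * #S < #X ∨ 3 * #B - n < 3 * #X := by
  classical
  by_contra! hcon
  have hXB : X.map (Function.Embedding.subtype _) ⊆ B := by
    intro j hj
    simp only [mem_map, Function.Embedding.subtype_apply] at hj
    obtain ⟨a, -, rfl⟩ := hj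
    exact a.2
  refine h ⟨S.map (Function.Embedding.subtype _), ?_, X.map (Function.Embedding.subtype _), hXB,
    ?_, ?_, ?_, ?_⟩
  · intro i hi
    simp only [mem_map, Function.Embedding.subtype_apply] at hi
    obtain ⟨a, -, rfl⟩ := hi
    exact a.2
  · exact hS.map
  · rw [card_map, card_map]; exact hcon.1
  · have := card_sdiff_add_card_eq_card hXB
    rw [card_map] at this
    omega
  · intro i hi j hj hg
    simp only [mem_map, Function.Embedding.subtype_apply] at hi
    obtain ⟨a, ha, rfl⟩ := hi
    rw [mem_sdiff] at hj
    by_contra! hlt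
    exact hj.2 (mem_map.2 ⟨⟨j, hj.1⟩, hX a ha ⟨j, hj.1⟩ ⟨hg, hlt⟩, rfl⟩)

theorem det_part {n : ℕ} (r t : ℕ) {F0 F1 : Finset (Fin n × Fin n)} (hF : IsConstraint F0 F1)
    (hn : 1 ≤ n) (hm : 3 * #F1 ≤ n) (δ K : ℝ) (hδ : 0 ≤ δ) (hK : (2 * t + 1) * δ ≤ K)
    (hr : 1 ≤ r) (hrt : n ≤ r ^ t) (C : Fin n × Fin n → ℝ) (hC : ∀ p, 0 ≤ C p)
    (hrow : ¬ ∃ S ⊆ AF F1, ∃ X ⊆ BF F1, S.Nonempty ∧ #X ≤ r * #S ∧ n ≤ 3 * #(BF F1 \ X) ∧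
      ∀ i ∈ S, ∀ j ∈ BF F1 \ X, id (i, j) ∈ OmegaF F0 F1 → δ < C (id (i, j)))
    (hcol : ¬ ∃ S ⊆ BF F1, ∃ X ⊆ AF F1, S.Nonempty ∧ #X ≤ r * #S ∧ n ≤ 3 * #(AF F1 \ X) ∧
      ∀ j ∈ S, ∀ i ∈ AF F1 \ X, Prod.swap (j, i) ∈ OmegaF F0 F1 → δ < C (Prod.swap (j, i))) :
    ∃ u v : Fin n → ℝ,
      (∀ p ∈ OmegaF F0 F1, u p.1 + v p.2 ≤ C p) ∧
      (∑ i ∈ AF F1, u i) + (∑ j ∈ BF F1, v j) = minMatchCost C F0 F1 ∧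
      (∀ i ∈ AF F1, |u i| ≤ 2 * K) ∧ (∀ j ∈ BF F1, |v j| ≤ 2 * K) := by
  classical
  have cA := card_AF hF
  have cB := card_BF hF
  have hK0 : 0 ≤ K := le_trans (by positivity) hK
  let α := {i // i ∈ AF F1}
  let β := {j // j ∈ BF F1}
  have hcα : Fintype.card α = #(AF F1) := Fintype.card_coe _
  have hcβ : Fintype.card β = #(BF F1) := Fintype.card_coe _
  let c : α → β → ℝ := fun i j => if (i.1, j.1) ∈ OmegaF F0 F1 then C (i.1, j.1) else K + 1
  have hc0 : ∀ i j, 0 ≤ c i j := by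
    intro i j
    simp only [c]
    split_ifs
    · exact hC _
    · linarith
  obtain ⟨u, v, e, huv, he⟩ := dual_exists (α := α) (β := β) (by omega) c
  let Gr : α → β → Prop := fun i j => (i.1, j.1) ∈ OmegaF F0 F1 ∧ C (i.1, j.1) ≤ δ
  have h1 : ∀ i, 0 ≤ u i + v (e i) := fun i => (he i).symm ▸ hc0 _ _
  have hsmall : ∀ i j, u i + v j ≤ K := by
    intro i j
    refine (dual_small e u v Gr δ r (3 * #(AF F1) - n) t hδ h1 ?_ ?_ ?_ hr ?_ ?_ ?_ i j).trans hK
    · intro i j hg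
      have := huv i j
      simp only [c, if_pos hg.1] at this
      exact this.trans hg.2
    · intro S hS X hX
      have := expansion_subtype r (AF F1) (BF F1) id (OmegaF F0 F1) δ C (by omega) hrow S hS X hX
      rwa [show #(AF F1) = #(BF F1) by omega]
    · intro S hS X hX
      exact expansion_subtype r (BF F1) (AF F1) Prod.swap (OmegaF F0 F1) δ C (by omega) hcol S hS X hX
    · omega
    · omega
    · omega
  have hbig : ∀ i j, -K ≤ u i + v j := by
    intro i j
    have a1 := h1 i
    have a2 := h1 (e.symm j)
    rw [e.apply_symm_apply] at a2
    have a3 := hsmall (e.symm j) (e i)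
    linarith
  have heΩ : ∀ i : α, (i.1, (e i).1) ∈ OmegaF F0 F1 := by
    intro i
    by_contra hcon
    have a := he i
    simp only [c, if_neg hcon] at a
    have := hsmall i (e i)
    linarith
  have hne : Nonempty α := by
    rw [← Fintype.card_pos_iff]; omega
  obtain ⟨i0⟩ := hne
  let U : Fin n → ℝ := fun i => if h : i ∈ AF F1 then u ⟨i, h⟩ - u i0 else 0
  let V : Fin n → ℝ := fun j => if h : j ∈ BF F1 then v ⟨j, h⟩ + u i0 else 0
  have hU : ∀ i (h : i ∈ AF F1), U i = u ⟨i, h⟩ - u i0 := fun i h => dif_pos h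
  have hV : ∀ j (h : j ∈ BF F1), V j = v ⟨j, h⟩ + u i0 := fun j h => dif_pos h
  have hfeas : ∀ p ∈ OmegaF F0 F1, U p.1 + V p.2 ≤ C p := by
    intro p hp
    rw [hU p.1 hp.1, hV p.2 hp.2.1]
    have := huv ⟨p.1, hp.1⟩ ⟨p.2, hp.2.1⟩
    simp only [c] at this
    rw [if_pos hp] at this
    linarith
  have hsum : ∀ σ : Fin n → Fin n, Set.BijOn σ (AF F1) (BF F1) →
      ∑ i ∈ AF F1, U i + ∑ j ∈ BF F1, V j = ∑ i ∈ AF F1, (U i + V (σ i)) := by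
    intro σ hσ
    rw [sum_add_distrib]
    congr 1
    symm
    exact sum_bij (fun i _ => σ i) (fun i hi => hσ.mapsTo hi) (fun i hi j hj h => hσ.injOn hi hj h)
      (fun j hj => by obtain ⟨i, hi, h⟩ := hσ.surjOn hj; exact ⟨i, hi, h⟩) (fun _ _ => rfl)
  refine ⟨U, V, hfeas, ?_, ?_, ?_⟩
  · symm
    apply IsLeast.csInf_eq
    constructor
    · let σ : Fin n → Fin n := fun i => if h : i ∈ AF F1 then (e ⟨i, h⟩).1 else i
      have hσ : ∀ i (h : i ∈ AF F1), σ i = (e ⟨i, h⟩).1 := fun i h => dif_pos h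
      have hbij : Set.BijOn σ (AF F1) (BF F1) := by
        refine ⟨?_, ?_, ?_⟩
        · intro i hi
          rw [hσ i hi]; exact (e _).2
        · intro i hi j hj h
          rw [hσ i hi, hσ j hj] at h
          have := e.injective (Subtype.ext h)
          exact congrArg Subtype.val this
        · intro j hj
          refine ⟨(e.symm ⟨j, hj⟩).1, (e.symm ⟨j, hj⟩).2, ?_⟩
          rw [hσ _ (e.symm ⟨j, hj⟩).2]
          simp
      refine ⟨σ, hbij, ?_, ?_⟩
      · intro i hi
        rw [hσ i hi]; exact heΩ ⟨i, hi⟩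
      · rw [hsum σ hbij]
        refine sum_congr rfl fun i hi => ?_
        have a := he ⟨i, hi⟩
        simp only [c] at a
        rw [if_pos (heΩ ⟨i, hi⟩)] at a
        rw [hσ i hi, hU i hi, hV _ (e ⟨i, hi⟩).2]
        simp only [Subtype.coe_eta]
        linarith
    · rintro x ⟨σ, hσ, hσΩ, rfl⟩
      rw [hsum σ hσ]
      exact sum_le_sum fun i hi => hfeas _ (hσΩ i hi)
  · intro i hi
    rw [hU i hi, abs_le]
    have a1 := hsmall ⟨i, hi⟩ (e i0)
    have a2 := hbig ⟨i, hi⟩ (e i0)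
    have a3 := hsmall i0 (e i0)
    have a4 := hbig i0 (e i0)
    constructor <;> linarith
  · intro j hj
    rw [hV j hj, abs_le]
    have a1 := hsmall i0 ⟨j, hj⟩
    have a2 := hbig i0 ⟨j, hj⟩
    constructor <;> linarith

/-- Numerical facts for large `n`. -/
theorem numerics (ε : ℝ) (hε : 0 < ε) (hε3 : ε ≤ 1 / 3) : ∃ N : ℕ, ∀ n : ℕ, N ≤ n →
    1 ≤ n ∧ (∀ a b : ℕ, (a : ℝ) ≤ (n : ℝ) ^ (3 * ε / 8) → (b : ℝ) ≤ (n : ℝ) ^ (3 * ε / 4) →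
      12 * (b + a + 1) ≤ n) ∧
    12 * (n : ℝ) ^ ⌈(n : ℝ) ^ (ε / 2)⌉₊ ≤ Real.exp ((⌈(n : ℝ) ^ ε⌉₊ : ℝ) / 2) ∧
    n ≤ ⌈(n : ℝ) ^ (ε / 2)⌉₊ ^ ⌈2 / ε⌉₊ := by
  have l1 : ∀ᶠ x : ℝ in Filter.atTop, 4 ≤ x ^ (ε / 4) :=
    (tendsto_rpow_atTop (by positivity)).eventually_ge_atTop 4
  have l2 : ∀ᶠ x : ℝ in Filter.atTop, ‖Real.log x‖ ≤ 1 * ‖x ^ (ε / 4)‖ :=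
    (isLittleO_log_rpow_atTop (by positivity : 0 < ε / 4)).bound one_pos
  have l3 := tendsto_natCast_atTop_atTop (R := ℝ) |>.eventually
    (l1.and (l2.and (Filter.eventually_ge_atTop 1)))
  obtain ⟨N, hN⟩ := Filter.eventually_atTop.1 l3
  refine ⟨N, fun n hn => ?_⟩
  obtain ⟨h4, hlog, hn1⟩ := hN n hn
  have hn0 : (0:ℝ) < n := by linarith
  set x := (n : ℝ) ^ (ε / 4) with hx
  have hx0 : 0 < x := by linarith
  rw [one_mul, Real.norm_of_nonneg hx0.le, Real.norm_of_nonneg (Real.log_nonneg hn1)] at hlog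
  have hp : ∀ k : ℕ, x ^ k = (n : ℝ) ^ (k * ε / 4) := by
    intro k
    rw [hx, ← Real.rpow_natCast, ← Real.rpow_mul hn0.le]; congr 1; ring
  have hx2 : (n : ℝ) ^ (ε / 2) = x ^ 2 := by rw [hp]; congr 1; push_cast; ring
  have hx4 : (n : ℝ) ^ ε = x ^ 4 := by rw [hp]; congr 1; push_cast; ring
  have hx3 : (n : ℝ) ^ (3 * ε / 4) = x ^ 3 := by rw [hp]; congr 1
  have hx12 : x ^ 12 ≤ n := by
    rw [hp]
    calc (n : ℝ) ^ (((12:ℕ):ℝ) * ε / 4) ≤ (n : ℝ) ^ (1:ℝ) :=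
          Real.rpow_le_rpow_of_exponent_le hn1 (by push_cast; linarith)
      _ = n := Real.rpow_one _
  refine ⟨by exact_mod_cast hn1, ?_, ?_, ?_⟩
  · intro a b ha hb
    have ha' : (a:ℝ) ≤ x ^ 3 := by
      rw [← hx3]
      exact ha.trans (Real.rpow_le_rpow_of_exponent_le hn1 (by linarith))
    rw [hx3] at hb
    have h3 : (64:ℝ) ≤ x ^ 3 := by
      calc (64:ℝ) = 4 ^ 3 := by norm_num
        _ ≤ x ^ 3 := pow_le_pow_left₀ (by norm_num) h4 3
    have h12 : x ^ 12 = (x ^ 3) ^ 4 := by ring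
    have : 12 * ((b:ℝ) + a + 1) ≤ n := by
      refine le_trans ?_ hx12
      rw [h12]
      have : (64:ℝ) ^ 3 * x ^ 3 ≤ (x ^ 3) ^ 4 := by
        rw [pow_succ (x ^ 3) 3]
        exact mul_le_mul_of_nonneg_right (pow_le_pow_left₀ (by norm_num) h3 3) (by positivity)
      linarith
    exact_mod_cast this
  · have hl : (12:ℝ) ≤ Real.exp 3 := by
      have : (2.7:ℝ) ^ 3 ≤ Real.exp 1 ^ 3 :=
        pow_le_pow_left₀ (by norm_num) (by linarith [Real.exp_one_gt_d9]) 3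
      rw [← Real.exp_nat_mul] at this
      norm_num at this ⊢
      linarith
    have hnr : (n:ℝ) ^ ⌈(n : ℝ) ^ (ε / 2)⌉₊ ≤ Real.exp ((x ^ 2 + 1) * x) := by
      rw [← Real.exp_log hn0, ← Real.exp_nat_mul, Real.exp_log hn0, Real.exp_le_exp]
      refine mul_le_mul ?_ hlog (Real.log_nonneg hn1) (by positivity)
      rw [← hx2]
      exact (Nat.ceil_lt_add_one (by positivity)).le
    calc _ ≤ Real.exp 3 * Real.exp ((x ^ 2 + 1) * x) := by gcongr
      _ = Real.exp (3 + (x ^ 2 + 1) * x) := by rw [Real.exp_add]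
      _ ≤ _ := by
        rw [Real.exp_le_exp]
        have : x ^ 4 ≤ (⌈(n : ℝ) ^ ε⌉₊ : ℝ) := by rw [← hx4]; exact Nat.le_ceil _
        have a1 : 4 * x ^ 3 ≤ x ^ 4 := by
          rw [pow_succ x 3, mul_comm]; exact mul_le_mul_of_nonneg_left h4 (by positivity)
        have a2 : 4 * x ^ 2 ≤ x ^ 3 := by
          rw [pow_succ x 2, mul_comm]; exact mul_le_mul_of_nonneg_left h4 (by positivity)
        have a3 : 4 * x ≤ x ^ 2 := by
          rw [pow_two]; exact mul_le_mul_of_nonneg_right h4 (by positivity)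
        nlinarith
  · have : (n:ℝ) ≤ (⌈(n : ℝ) ^ (ε / 2)⌉₊ : ℝ) ^ ⌈2 / ε⌉₊ := by
      calc (n:ℝ) = (n:ℝ) ^ (1:ℝ) := (Real.rpow_one _).symm
        _ ≤ (n:ℝ) ^ (ε / 2 * (⌈2 / ε⌉₊ : ℝ)) := by
          apply Real.rpow_le_rpow_of_exponent_le hn1
          have := Nat.le_ceil (2 / ε)
          calc (1:ℝ) = ε / 2 * (2 / ε) := by field_simp
            _ ≤ _ := by gcongr
        _ = ((n:ℝ) ^ (ε / 2)) ^ ⌈2 / ε⌉₊ := by rw [Real.rpow_mul hn0.le, Real.rpow_natCast]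
        _ ≤ _ := by gcongr; exact Nat.le_ceil _
    exact_mod_cast this

/-- for sufficiently small `ε > 0` and sufficiently large `n`, for every
fixed constraint pair `F` satisfying (⋆), with probability at least `1 − n e^{−ζ}` there
are dual variables `u, v`, feasible on `Ω_F`, whose total equals the minimum matching cost,
with `|u_i|, |v_j| ≤ 2γ_ε`. -/
theorem statement_8 :
    ∃ ε₀ : ℝ, 0 < ε₀ ∧ ∀ ε : ℝ, 0 < ε → ε ≤ ε₀ →
      ∃ N : ℕ, ∀ n : ℕ, N ≤ n →
        ∀ F0 F1 : Finset (Fin n × Fin n), IsConstraint F0 F1 → StarCond ε F0 F1 →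
          ENNReal.ofReal (1 - n * Real.exp (-(⌈(n : ℝ) ^ ε⌉₊ : ℝ))) ≤
            costMeasure n
              {C | ∃ u v : Fin n → ℝ,
                (∀ p ∈ OmegaF F0 F1, u p.1 + v p.2 ≤ C p) ∧
                (∑ i ∈ AF F1, u i) + (∑ j ∈ BF F1, v j) = minMatchCost C F0 F1 ∧
                (∀ i ∈ AF F1, |u i| ≤ 2 * (30 * (⌈(n : ℝ) ^ ε⌉₊ : ℝ) / (ε * n))) ∧
                (∀ j ∈ BF F1, |v j| ≤ 2 * (30 * (⌈(n : ℝ) ^ ε⌉₊ : ℝ) / (ε * n)))} := by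
  refine ⟨1 / 3, by norm_num, fun ε hε hε3 => ?_⟩
  obtain ⟨N, hN⟩ := numerics ε hε hε3
  refine ⟨N, fun n hn F0 F1 hF hstar => ?_⟩
  obtain ⟨hn1, hdeg, hexp, hrt⟩ := hN n hn
  have hd := hdeg _ _ hstar.1 hstar.2
  have hn0 : (0:ℝ) < n := by exact_mod_cast hn1
  set ζ : ℝ := (⌈(n : ℝ) ^ ε⌉₊ : ℝ) with hζ
  set r := ⌈(n : ℝ) ^ (ε / 2)⌉₊ with hr
  set t := ⌈2 / ε⌉₊ with ht
  have hr1 : 1 ≤ r := Nat.ceil_pos.2 (by positivity)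
  have hζ0 : 0 ≤ ζ := Nat.cast_nonneg _
  have hnr : (n:ℝ) ≤ (n:ℝ) ^ r := le_self_pow₀ (by exact_mod_cast hn1) (by omega)
  have hy : Real.exp (-(3 / 2) * ζ) * (n:ℝ) ^ r * 12 ≤ Real.exp (-ζ) := by
    calc Real.exp (-(3 / 2) * ζ) * (n:ℝ) ^ r * 12
        = Real.exp (-(3 / 2) * ζ) * (12 * (n:ℝ) ^ r) := by ring
      _ ≤ Real.exp (-(3 / 2) * ζ) * Real.exp (ζ / 2) := by gcongr
      _ = Real.exp (-ζ) := by rw [← Real.exp_add]; congr 1; ring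
  have hq : n * (Real.exp (-(3 / 2) * ζ) * (n:ℝ) ^ r) ≤ 1 := by
    have h1 : (n:ℝ) ≤ Real.exp ζ := by
      have : Real.exp (ζ / 2) ≤ Real.exp ζ := Real.exp_le_exp.2 (by linarith)
      linarith
    calc n * (Real.exp (-(3 / 2) * ζ) * (n:ℝ) ^ r) ≤ Real.exp ζ * Real.exp (-ζ) := by
          gcongr
          have : 0 ≤ Real.exp (-(3 / 2) * ζ) * (n:ℝ) ^ r := by positivity
          linarith
      _ = 1 := by rw [← Real.exp_add]; simp
  set δ : ℝ := 6 * ζ / n with hδ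
  have hK : (2 * t + 1) * δ ≤ 30 * ζ / (ε * n) := by
    have h1 : (t:ℝ) < 2 / ε + 1 := Nat.ceil_lt_add_one (by positivity)
    have h2 : (2 * t + 1 : ℝ) ≤ 5 / ε := by
      have : 3 ≤ 1 / ε := by rw [le_div_iff₀ hε]; linarith
      have e1 : 5 / ε = 2 * (2 / ε) + 1 / ε := by ring
      linarith
    calc (2 * t + 1) * δ ≤ 5 / ε * δ := by gcongr
      _ = _ := by rw [hδ]; field_simp; ring
  have p1 := prob_bad n r hn1 (AF F1) (BF F1) id Function.injective_id (OmegaF F0 F1) _ hd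
    (deg_row hF) δ ζ hζ0 hδ hq
  have p2 := prob_bad n r hn1 (BF F1) (AF F1) Prod.swap Prod.swap_injective (OmegaF F0 F1) _ hd
    (deg_col hF) δ ζ hζ0 hδ hq
  have p0 : costMeasure n (⋃ p : Fin n × Fin n, {C | C p < 0}) = 0 :=
    measure_iUnion_null fun p => prob_neg n p
  have hprob : costMeasure n Set.univ = 1 := by
    rw [costMeasure, Measure.pi_univ]; simp
  set G1 := {C : Fin n × Fin n → ℝ | ∃ S ⊆ AF F1, ∃ X ⊆ BF F1, S.Nonempty ∧ #X ≤ r * #S ∧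
    n ≤ 3 * #(BF F1 \ X) ∧ ∀ i ∈ S, ∀ j ∈ BF F1 \ X, id (i, j) ∈ OmegaF F0 F1 → δ < C (id (i, j))}
    with hG1
  set G2 := {C : Fin n × Fin n → ℝ | ∃ S ⊆ BF F1, ∃ X ⊆ AF F1, S.Nonempty ∧ #X ≤ r * #S ∧
    n ≤ 3 * #(AF F1 \ X) ∧
    ∀ i ∈ S, ∀ j ∈ AF F1 \ X, Prod.swap (i, j) ∈ OmegaF F0 F1 → δ < C (Prod.swap (i, j))} with hG2
  set T := {C : Fin n × Fin n → ℝ | ∃ u v : Fin n → ℝ,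
                (∀ p ∈ OmegaF F0 F1, u p.1 + v p.2 ≤ C p) ∧
                (∑ i ∈ AF F1, u i) + (∑ j ∈ BF F1, v j) = minMatchCost C F0 F1 ∧
                (∀ i ∈ AF F1, |u i| ≤ 2 * (30 * ζ / (ε * n))) ∧
                (∀ j ∈ BF F1, |v j| ≤ 2 * (30 * ζ / (ε * n)))} with hT
  have hcover : Set.univ ⊆ T ∪ ((⋃ p : Fin n × Fin n, {C | C p < 0}) ∪ (G1 ∪ G2)) := by
    intro C _
    by_contra hcon
    simp only [Set.mem_union, not_or] at hcon
    obtain ⟨c1, c2, c3, c4⟩ := hcon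
    apply c1
    refine det_part r t hF hn1 (by omega) δ _ (by positivity) hK hr1 hrt C ?_ c3 c4
    intro p
    by_contra! hneg
    exact c2 (Set.mem_iUnion.2 ⟨p, hneg⟩)
  have hb : (1 : ENNReal) ≤ costMeasure n T + ENNReal.ofReal (n * Real.exp (-ζ)) := by
    calc (1 : ENNReal) = costMeasure n Set.univ := hprob.symm
      _ ≤ costMeasure n T + (costMeasure n (⋃ p : Fin n × Fin n, {C | C p < 0}) +
          (costMeasure n G1 + costMeasure n G2)) := by
        refine (measure_mono hcover).trans ((measure_union_le _ _).trans ?_)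
        gcongr
        refine (measure_union_le _ _).trans ?_
        gcongr
        exact measure_union_le _ _
      _ ≤ costMeasure n T + ENNReal.ofReal (n * Real.exp (-ζ)) := by
        rw [p0, zero_add]
        gcongr
        refine (add_le_add p1 p2).trans ?_
        rw [← ENNReal.ofReal_add (by positivity) (by positivity)]
        apply ENNReal.ofReal_le_ofReal
        have := mul_le_mul_of_nonneg_left hy hn0.le
        linarith
  rw [ENNReal.ofReal_sub _ (by positivity), ENNReal.ofReal_one]
  exact tsub_le_iff_right.2 hb
end
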